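/- Let S = R ∪ B be a bicolored point set in convex position with |R| = |B| = n ≥ 1, and let r ∈ R and b ∈ B. Then there exists a 1-plane Hamiltonian alternating path on S with endpoints r and b if and only if the configuration (S, r, b) is non-special. -/

import Mathlib

open scoped Classical

noncomputable section

/-- Points of the plane. -/
abbrev Pt := ℝ × ℝ

/-- Orientation determinant of the ordered triple `(a, b, c)`. -/
def det2 (a b c : Pt) : ℝ :=
  (b.1 - a.1) * (c.2 - a.2) - (b.2 - a.2) * (c.1 - a.1)

/-- Two closed segments cross: some point lies in the relative interior of both. -/
def SegCross (e f : Pt × Pt) : Prop :=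
  ∃ x : Pt, x ∈ openSegment ℝ e.1 e.2 ∧ x ∈ openSegment ℝ f.1 f.2

/-- Number of crossings (unordered pairs of crossing edges) among a list of edges. -/
def crossNum (es : List (Pt × Pt)) : ℕ :=
  ((Finset.range es.length ×ˢ Finset.range es.length).filter
    (fun ij => ij.1 < ij.2 ∧
      SegCross (es.getD ij.1 ((0, 0), (0, 0))) (es.getD ij.2 ((0, 0), (0, 0))))).card

/-- Number of other edges crossing the `i`-th edge of the list. -/
def edgeCrossCount (es : List (Pt × Pt)) (i : ℕ) : ℕ :=
  ((Finset.range es.length).filter (fun j => j ≠ i ∧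
      SegCross (es.getD i ((0, 0), (0, 0))) (es.getD j ((0, 0), (0, 0))))).card

/-- Every edge is crossed by at most one other edge. -/
def OnePlane (es : List (Pt × Pt)) : Prop :=
  ∀ i ∈ Finset.range es.length, edgeCrossCount es i ≤ 1

/-- The edges of a path given by its list of vertices. -/
def pathEdges (l : List Pt) : List (Pt × Pt) := l.zip l.tail

/-- The edges of a cycle given by its list of vertices (including the wrap-around edge). -/
def cycleEdges (l : List Pt) : List (Pt × Pt) := l.zip (l.rotate 1)

/-- An edge joining a point of `R` to a point of `B`. -/
def Bichromatic (R B : Finset Pt) (e : Pt × Pt) : Prop :=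
  (e.1 ∈ R ∧ e.2 ∈ B) ∨ (e.1 ∈ B ∧ e.2 ∈ R)

/-- A Hamiltonian alternating path on the bicolored point set `R ∪ B`
with endpoints `p` and `q`. -/
structure HamAltPath (R B : Finset Pt) (p q : Pt) where
  verts : List Pt
  nodup : verts.Nodup
  cover : verts.toFinset = R ∪ B
  head_eq : verts.head? = some p
  last_eq : verts.getLast? = some q
  alt : ∀ e ∈ pathEdges verts, Bichromatic R B e

/-- A Hamiltonian alternating cycle on the bicolored point set `R ∪ B`. -/
structure HamAltCycle (R B : Finset Pt) where
  verts : List Pt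
  nodup : verts.Nodup
  cover : verts.toFinset = R ∪ B
  alt : ∀ e ∈ cycleEdges verts, Bichromatic R B e

/-- A Hamiltonian alternating path with prescribed endpoints is optimum if it has the
minimum number of crossings among all such paths. -/
def OptimumPath (R B : Finset Pt) (p q : Pt) (P : HamAltPath R B p q) : Prop :=
  ∀ Q : HamAltPath R B p q, crossNum (pathEdges P.verts) ≤ crossNum (pathEdges Q.verts)

/-- No three points of `S` are collinear. -/
def GeneralPosition (S : Finset Pt) : Prop :=
  ∀ p ∈ S, ∀ q ∈ S, ∀ r ∈ S, p ≠ q → p ≠ r → q ≠ r → ¬ Collinear ℝ ({p, q, r} : Set Pt)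

/-- Every point of `S` is a vertex (extreme point) of its convex hull. -/
def ConvexPosition (S : Finset Pt) : Prop :=
  ∀ p ∈ S, p ∉ convexHull ℝ ((S.erase p : Finset Pt) : Set Pt)

/-- The points of `S` lying on the boundary of the convex hull of `S`
(i.e. the extreme points of `S`). -/
def hullPts (S : Finset Pt) : Finset Pt :=
  S.filter fun p => p ∉ convexHull ℝ ((S.erase p : Finset Pt) : Set Pt)

/-- Cyclic successor on `Fin m`. -/
def cycSucc {m : ℕ} (hm : 0 < m) (i : Fin m) : Fin m :=
  ⟨(i.val + 1) % m, Nat.mod_lt _ hm⟩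

/-- Cyclic predecessor on `Fin m`. -/
def cycPred {m : ℕ} (hm : 0 < m) (i : Fin m) : Fin m :=
  ⟨(i.val + (m - 1)) % m, Nat.mod_lt _ hm⟩

/-- `pt` lists points in convex position, in clockwise circular order:
every index-increasing triple is clockwise oriented. -/
def CWList {m : ℕ} (pt : Fin m → Pt) : Prop :=
  Function.Injective pt ∧
    ∀ i j k : Fin m, i < j → j < k → det2 (pt i) (pt j) (pt k) < 0

/-- `pt` is a clockwise listing of the points of `S` on the boundary of `CH(S)`. -/
def IsHullList (S : Finset Pt) {m : ℕ} (pt : Fin m → Pt) : Prop :=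
  CWList pt ∧ Finset.univ.image pt = hullPts S

/-- The number of runs of color `A` (with other color `C`) in the cyclic sequence `pt`:
a run starts at an `A`-point whose cyclic predecessor is a `C`-point; a completely
`A`-colored cycle forms a single run. -/
def runCount {m : ℕ} (hm : 0 < m) (A C : Finset Pt) (pt : Fin m → Pt) : ℕ :=
  if ∀ i : Fin m, pt i ∈ A then 1
  else (Finset.univ.filter fun i : Fin m => pt i ∈ A ∧ pt (cycPred hm i) ∈ C).card

/-- `q` is the counterclockwise radial order of the points of `T` around `r`. -/
def CCWOrder (r : Pt) {k : ℕ} (q : Fin k → Pt) (T : Finset Pt) : Prop :=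
  Function.Injective q ∧ Finset.univ.image q = T ∧
    ∀ i j : Fin k, i < j → 0 < det2 r (q i) (q j)

/-- `q` is the clockwise radial order of the points of `T` around `r`. -/
def CWOrder (r : Pt) {k : ℕ} (q : Fin k → Pt) (T : Finset Pt) : Prop :=
  Function.Injective q ∧ Finset.univ.image q = T ∧
    ∀ i j : Fin k, i < j → det2 r (q i) (q j) < 0

/-- Counting one extra point of color `A` (the center), the initial segment
`q 0, …, q j` contains equally many points of color `A` and of color `C`. -/
def BalancedAt (A C : Finset Pt) {k : ℕ} (q : Fin k → Pt) (j : Fin k) : Prop :=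
  1 + (Finset.univ.filter fun i : Fin k => i ≤ j ∧ q i ∈ A).card
    = (Finset.univ.filter fun i : Fin k => i ≤ j ∧ q i ∈ C).card

/-- `j` is the first balanced index of the sequence `q`. -/
def FirstBalanced (A C : Finset Pt) {k : ℕ} (q : Fin k → Pt) (j : Fin k) : Prop :=
  BalancedAt A C q j ∧ ∀ j' : Fin k, j' < j → ¬ BalancedAt A C q j'

/-- The triple `(R ∪ B, r, b)` is a special configuration (Definition 2.2):
(i) both neighbors of `r` on the hull boundary are red and both neighbors of `b` are
blue; (ii) in the counterclockwise and clockwise radial orders around `r`, the first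
balanced point is `b`; (iii) symmetrically around `b`, the first balanced point is `r`. -/
def SpecialConfig (R B : Finset Pt) (r b : Pt) : Prop :=
  r ∈ hullPts (R ∪ B) ∧ b ∈ hullPts (R ∪ B) ∧
  (∀ (m : ℕ) (hm : 0 < m) (pt : Fin m → Pt), IsHullList (R ∪ B) pt →
    ∀ i : Fin m,
      (pt i = r → pt (cycPred hm i) ∈ R ∧ pt (cycSucc hm i) ∈ R) ∧
      (pt i = b → pt (cycPred hm i) ∈ B ∧ pt (cycSucc hm i) ∈ B)) ∧
  (∀ (k : ℕ) (q : Fin k → Pt),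
      (CCWOrder r q ((R ∪ B).erase r) ∨ CWOrder r q ((R ∪ B).erase r)) →
      ∀ j : Fin k, FirstBalanced R B q j → q j = b) ∧
  (∀ (k : ℕ) (q : Fin k → Pt),
      (CCWOrder b q ((R ∪ B).erase b) ∨ CWOrder b q ((R ∪ B).erase b)) →
      ∀ j : Fin k, FirstBalanced B R q j → q j = r)

/-- The unordered pair `{a, b}` occurs as an edge of the list `es`. -/
def IsEdgeOf (es : List (Pt × Pt)) (a b : Pt) : Prop := (a, b) ∈ es ∨ (b, a) ∈ es

/-- The clockwise cyclic interval of indices from `a` to `b`, inclusive. -/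
def cycIdx {m : ℕ} (hm : 0 < m) (a b : Fin m) : Finset (Fin m) :=
  (Finset.range ((b.val + m - a.val) % m + 1)).image
    fun t => (⟨(a.val + t) % m, Nat.mod_lt _ hm⟩ : Fin m)

/-- `x` lies strictly between `a` and `b`. -/
def StrictBtw (a b x : ℤ) : Prop := (a < x ∧ x < b) ∨ (b < x ∧ x < a)

/-- `x` lies strictly outside the interval spanned by `a` and `b`. -/
def StrictOut (a b x : ℤ) : Prop := (x < a ∧ x < b) ∨ (a < x ∧ b < x)

/-- The chords `e` and `f` of a convex polygon with integer-labelled vertices interleave. -/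
def Interleave (e f : ℤ × ℤ) : Prop :=
  (StrictBtw e.1 e.2 f.1 ∧ StrictOut e.1 e.2 f.2) ∨
    (StrictBtw e.1 e.2 f.2 ∧ StrictOut e.1 e.2 f.1)

/-- The pairs of consecutive entries of a list. -/
def consec {α : Type*} (l : List α) : List (α × α) := l.zip l.tail

/-- Every consecutive pair of `l` interleaves with at most one other. -/
def IdxOnePlane (l : List ℤ) : Prop :=
  ∀ e ∈ consec l, ∀ f ∈ consec l, ∀ g ∈ consec l, Interleave e f → Interleave e g → f = g

/-- `l` is a 1-plane path from `s` to `t`, alternating for the colouring `c`, whose vertices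
are exactly the labels satisfying `V`. -/
def IsAltPath (c : ℤ → ℤ) (s t : ℤ) (V : ℤ → Prop) (l : List ℤ) : Prop :=
  l.head? = some s ∧ l.getLast? = some t ∧ l.Nodup ∧ (∀ x, x ∈ l ↔ V x) ∧
    (∀ e ∈ consec l, c e.1 ≠ c e.2) ∧ IdxOnePlane l

/-- There is a 1-plane alternating path from `s` to `t` with vertex set `V`. -/
def HasPath (c : ℤ → ℤ) (s t : ℤ) (V : ℤ → Prop) : Prop :=
  ∃ l : List ℤ, IsAltPath c s t V l

section Consec

variable {α β : Type*}

@[simp] lemma consec_nil : consec ([] : List α) = [] := rfl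

@[simp] lemma consec_singleton (a : α) : consec [a] = [] := rfl

@[simp] lemma consec_cons_cons (a b : α) (l : List α) :
    consec (a :: b :: l) = (a, b) :: consec (b :: l) := rfl

lemma consec_append_cons (l₁ : List α) (t : α) (l₂ : List α) :
    consec (l₁ ++ t :: l₂) = consec (l₁ ++ [t]) ++ consec (t :: l₂) := by
  induction l₁ with
  | nil => simp
  | cons a l ih =>
    cases l with
    | nil => simp
    | cons b l => simpa using ih

lemma consec_map (f : α → β) (l : List α) :
    consec (l.map f) = (consec l).map (Prod.map f f) := by
  unfold consec
  rw [← List.map_tail, List.zip_map]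

lemma mem_of_mem_consec {l : List α} {e : α × α} (he : e ∈ consec l) : e.1 ∈ l ∧ e.2 ∈ l := by
  obtain ⟨a, b⟩ := e
  have h := List.of_mem_zip he
  exact ⟨h.1, List.mem_of_mem_tail h.2⟩

lemma mem_consec_reverse {l : List α} {e : α × α} :
    e ∈ consec l.reverse ↔ e.swap ∈ consec l := by
  induction l with
  | nil => simp
  | cons a l ih =>
    cases l with
    | nil => simp
    | cons b l =>
      have : (a :: b :: l).reverse = l.reverse ++ b :: [a] := by simp
      rw [this, consec_append_cons]
      have h2 : l.reverse ++ [b] = (b :: l).reverse := by simp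
      rw [h2, List.mem_append, ih]
      obtain ⟨x, y⟩ := e
      simp only [consec_cons_cons, consec_singleton, List.mem_cons, List.not_mem_nil, Prod.swap,
        Prod.mk.injEq, or_false]
      tauto

lemma exists_consec_leaving {Q : α → Prop} : ∀ {l : List α} {a z : α}, a ∈ l → Q a →
    l.getLast? = some z → ¬ Q z → ∃ e ∈ consec l, Q e.1 ∧ ¬ Q e.2
  | [], _, _, ha, _, _, _ => by simp at ha
  | [u], a, z, ha, hQ, hz, hn => by
    simp at ha hz
    subst ha hz
    exact absurd hQ hn
  | u :: v :: l, a, z, ha, hQ, hz, hn => by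
    by_cases hv : ∃ w ∈ v :: l, Q w
    · obtain ⟨w, hw, hQw⟩ := hv
      obtain ⟨e, he, h⟩ := exists_consec_leaving (l := v :: l) hw hQw (by simpa using hz) hn
      exact ⟨e, by simp [he], h⟩
    · push Not at hv
      rcases List.mem_cons.1 ha with rfl | ha
      · exact ⟨(a, v), by simp, hQ, hv v (by simp)⟩
      · exact absurd hQ (hv a ha)

lemma exists_consec_entering {Q : α → Prop} : ∀ {l : List α} {a z : α}, a ∈ l → Q a →
    l.head? = some z → ¬ Q z → ∃ e ∈ consec l, ¬ Q e.1 ∧ Q e.2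
  | [], _, _, ha, _, _, _ => by simp at ha
  | [u], a, z, ha, hQ, hz, hn => by
    simp at ha hz
    subst ha hz
    exact absurd hQ hn
  | u :: v :: l, a, z, ha, hQ, hz, hn => by
    simp at hz
    subst hz
    by_cases hv : Q v
    · exact ⟨(u, v), by simp, hn, hv⟩
    · rcases List.mem_cons.1 ha with rfl | ha
      · exact absurd hQ hn
      · obtain ⟨e, he, h⟩ := exists_consec_entering (l := v :: l) ha hQ (by simp) hv
        exact ⟨e, by simp [he], h⟩

lemma nodup_consec : ∀ {l : List α}, l.Nodup → (consec l).Nodup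
  | [], _ => by simp
  | [u], _ => by simp
  | u :: v :: l, hl => by
    rw [List.nodup_cons] at hl
    rw [consec_cons_cons, List.nodup_cons]
    exact ⟨fun h => hl.1 (mem_of_mem_consec h).1, nodup_consec hl.2⟩

lemma fst_ne_snd_of_mem_consec : ∀ {l : List α}, l.Nodup → ∀ e ∈ consec l, e.1 ≠ e.2
  | [], _, e, he => by simp at he
  | [u], _, e, he => by simp at he
  | u :: v :: l, hl, e, he => by
    simp only [consec_cons_cons, List.mem_cons] at he
    rcases he with rfl | he
    · simp at hl
      tauto
    · exact fst_ne_snd_of_mem_consec (List.Nodup.of_cons hl) e he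

lemma swap_notMem_consec : ∀ {l : List α}, l.Nodup → ∀ e ∈ consec l, e.swap ∉ consec l
  | [], _, e, he => by simp at he
  | [u], _, e, he => by simp at he
  | u :: v :: l, hl, e, he => by
    have hl' := hl
    rw [List.nodup_cons] at hl
    have key : ∀ e ∈ consec (v :: l), e.1 ≠ u ∧ e.2 ≠ u := fun e he =>
      ⟨fun h => hl.1 (h ▸ (mem_of_mem_consec he).1), fun h => hl.1 (h ▸ (mem_of_mem_consec he).2)⟩
    simp only [consec_cons_cons, List.mem_cons] at he ⊢
    rcases he with rfl | he
    · rintro (h | h)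
      · simp at h
        simp [h.1] at hl
      · exact (key _ h).2 rfl
    · rintro (h | h)
      · have := congrArg Prod.fst h
        exact (key _ he).2 this
      · exact swap_notMem_consec hl.2 e he h

end Consec

lemma Interleave.symm {e f : ℤ × ℤ} (h : Interleave e f) : Interleave f e := by
  unfold Interleave StrictBtw StrictOut at *
  omega

lemma interleave_swap_left {e f : ℤ × ℤ} : Interleave e.swap f ↔ Interleave e f := by
  unfold Interleave StrictBtw StrictOut
  simp only [Prod.fst_swap, Prod.snd_swap]
  omega

lemma interleave_swap_right {e f : ℤ × ℤ} : Interleave e f.swap ↔ Interleave e f := by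
  unfold Interleave StrictBtw StrictOut
  simp only [Prod.fst_swap, Prod.snd_swap]
  omega

/-- Relabelling a path along a map that creates no new crossings. -/
lemma IsAltPath.map {c c' : ℤ → ℤ} {s t : ℤ} {V W : ℤ → Prop} {l : List ℤ} (f : ℤ → ℤ)
    (h : IsAltPath c' s t V l)
    (hinj : ∀ x y, V x → V y → f x = f y → x = y) (hc : ∀ x, V x → c (f x) = c' x)
    (hX : ∀ x y z w, V x → V y → V z → V w →
      Interleave (f x, f y) (f z, f w) → Interleave (x, y) (z, w))
    (hW : ∀ y, W y ↔ ∃ x, V x ∧ f x = y) :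
    IsAltPath c (f s) (f t) W (l.map f) := by
  obtain ⟨h1, h2, h3, h4, h5, h6⟩ := h
  refine ⟨by simp [h1], by simp [h2], ?_, ?_, ?_, ?_⟩
  · exact h3.map_on fun x hx y hy => hinj x y ((h4 x).1 hx) ((h4 y).1 hy)
  · intro y
    simp [hW, h4]
  · intro e he
    rw [consec_map, List.mem_map] at he
    obtain ⟨e, he, rfl⟩ := he
    have := mem_of_mem_consec he
    simp only [Prod.map_fst, Prod.map_snd]
    rw [hc _ ((h4 _).1 this.1), hc _ ((h4 _).1 this.2)]
    exact h5 e he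
  · have key : ∀ e ∈ consec l, ∀ g ∈ consec l,
        Interleave (Prod.map f f e) (Prod.map f f g) → Interleave e g := by
      intro e he g hg
      have h1 := mem_of_mem_consec he
      have h2 := mem_of_mem_consec hg
      exact hX _ _ _ _ ((h4 _).1 h1.1) ((h4 _).1 h1.2) ((h4 _).1 h2.1) ((h4 _).1 h2.2)
    intro e he f' hf g hg hef heg
    rw [consec_map, List.mem_map] at he hf hg
    obtain ⟨e, he, rfl⟩ := he
    obtain ⟨f', hf, rfl⟩ := hf
    obtain ⟨g, hg, rfl⟩ := hg
    rw [h6 e he f' hf g hg (key e he f' hf hef) (key e he g hg heg)]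

namespace HasPath

variable {c : ℤ → ℤ} {s t : ℤ} {V W : ℤ → Prop}

lemma congr (h : HasPath c s t V) (hVW : ∀ x, V x ↔ W x) : HasPath c s t W := by
  obtain ⟨l, h1, h2, h3, h4, h5⟩ := h
  exact ⟨l, h1, h2, h3, fun x => (h4 x).trans (hVW x), h5⟩

lemma neg (h : HasPath (fun x => - c x) s t V) : HasPath c s t V := by
  obtain ⟨l, h1, h2, h3, h4, h5, h6⟩ := h
  exact ⟨l, h1, h2, h3, h4, fun e he h => h5 e he (by simp [h]), h6⟩

lemma reverse (h : HasPath c s t V) : HasPath c t s V := by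
  obtain ⟨l, h1, h2, h3, h4, h5, h6⟩ := h
  refine ⟨l.reverse, by simpa, by simpa, by simpa, by simpa, ?_, ?_⟩
  · intro e he
    exact (h5 _ (mem_consec_reverse.1 he)).symm
  · intro e he f hf g hg hef heg
    rw [mem_consec_reverse] at he hf hg
    exact Prod.swap_injective (h6 _ he _ hf _ hg
      (interleave_swap_left.2 (interleave_swap_right.2 hef))
      (interleave_swap_left.2 (interleave_swap_right.2 heg)))

lemma edge {a b : ℤ} (hab : c a ≠ c b) : HasPath c a b (fun x => x = a ∨ x = b) := by
  refine ⟨[a, b], rfl, rfl, ?_, by simp, by simpa using hab, ?_⟩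
  · simp
    rintro rfl
    exact hab rfl
  · intro e he f hf g hg _ _
    simp at hf hg
    rw [hf, hg]

/-- Two paths meeting in one common vertex, no edges of which can interleave, concatenate. -/
lemma trans {u : ℤ} (h₁ : HasPath c s t V) (h₂ : HasPath c t u W)
    (hVW : ∀ x, V x → W x → x = t)
    (hX : ∀ x y z w, V x → V y → W z → W w → ¬ Interleave (x, y) (z, w)) :
    HasPath c s u (fun x => V x ∨ W x) := by
  obtain ⟨l, h1, h2, h3, h4, h5, h6⟩ := h₁
  obtain ⟨m, g1, g2, g3, g4, g5, g6⟩ := h₂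
  obtain ⟨l', rfl⟩ := List.getLast?_eq_some_iff.1 h2
  obtain ⟨m', rfl⟩ := List.head?_eq_some_iff.1 g1
  have hX' : ∀ e ∈ consec (l' ++ [t]), ∀ f ∈ consec (t :: m'), ¬ Interleave e f := by
    intro e he f hf
    have h1 := mem_of_mem_consec he
    have h2 := mem_of_mem_consec hf
    exact hX _ _ _ _ ((h4 _).1 h1.1) ((h4 _).1 h1.2) ((g4 _).1 h2.1) ((g4 _).1 h2.2)
  refine ⟨l' ++ t :: m', ?_, ?_, ?_, ?_, ?_, ?_⟩
  · cases l' <;> simpa using h1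
  · rw [List.getLast?_append, g2]
    rfl
  · rw [List.nodup_append] at h3 ⊢
    refine ⟨h3.1, g3, ?_⟩
    intro a ha b hb hab
    subst hab
    have : a = t := hVW a ((h4 a).1 (by simp [ha])) ((g4 a).1 hb)
    exact h3.2.2 a ha t (by simp) this
  · intro x
    simp only [← h4, ← g4]
    simp
    tauto
  · intro e he
    rw [consec_append_cons, List.mem_append] at he
    rcases he with he | he
    exacts [h5 e he, g5 e he]
  · intro e he f hf g hg hef heg
    rw [consec_append_cons, List.mem_append] at he hf hg
    rcases he with he | he
    · rcases hf with hf | hf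
      · rcases hg with hg | hg
        · exact h6 e he f hf g hg hef heg
        · exact absurd heg (hX' e he g hg)
      · exact absurd hef (hX' e he f hf)
    · rcases hf with hf | hf
      · exact absurd hef.symm (hX' f hf e he)
      · rcases hg with hg | hg
        · exact absurd heg.symm (hX' g hg e he)
        · exact g6 e he f hf g hg hef heg

/-- Extending a path by an edge at each end; the new edges may only cross each other. -/
lemma extend {a z : ℤ} (h : HasPath c s t V) (ha : ¬ V a) (hz : ¬ V z) (haz : a ≠ z)
    (hca : c a ≠ c s) (hcz : c t ≠ c z)
    (hXa : ∀ x y, V x → V y → ¬ Interleave (a, s) (x, y))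
    (hXz : ∀ x y, V x → V y → ¬ Interleave (t, z) (x, y)) :
    HasPath c a z (fun x => x = a ∨ V x ∨ x = z) := by
  obtain ⟨l, h1, h2, h3, h4, h5, h6⟩ := h
  have hE : ∀ e, e ∈ consec (a :: (l ++ [z])) ↔ e = (a, s) ∨ e ∈ consec l ∨ e = (t, z) := by
    intro e
    obtain ⟨l', rfl⟩ := List.getLast?_eq_some_iff.1 h2
    have hs : consec (a :: (l' ++ [t])) = (a, s) :: consec (l' ++ [t]) := by
      cases l' with
      | nil => simp at h1 ⊢; exact h1
      | cons b l' => simp at h1 ⊢; exact h1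
    have : a :: (l' ++ [t] ++ [z]) = (a :: l') ++ t :: [z] := by simp
    rw [this, consec_append_cons, List.cons_append, hs]
    simp
  have hXa' : ∀ f ∈ consec l, ¬ Interleave (a, s) f := fun f hf =>
    hXa _ _ ((h4 _).1 (mem_of_mem_consec hf).1) ((h4 _).1 (mem_of_mem_consec hf).2)
  have hXz' : ∀ f ∈ consec l, ¬ Interleave (t, z) f := fun f hf =>
    hXz _ _ ((h4 _).1 (mem_of_mem_consec hf).1) ((h4 _).1 (mem_of_mem_consec hf).2)
  have hself : ∀ e : ℤ × ℤ, ¬ Interleave e e := by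
    intro e
    unfold Interleave StrictBtw StrictOut
    omega
  refine ⟨a :: (l ++ [z]), rfl, ?_, ?_, ?_, ?_, ?_⟩
  · simp [List.getLast?_cons]
  · rw [List.nodup_cons, List.nodup_append]
    refine ⟨by simp [h4, ha, haz], h3, by simp, ?_⟩
    intro x hx y hy hxy
    simp at hy
    subst hxy hy
    exact hz ((h4 _).1 hx)
  · intro x
    simp [h4]
  · intro e he
    rw [hE] at he
    rcases he with rfl | he | rfl
    exacts [hca, h5 e he, hcz]
  · intro e he f hf g hg hef heg
    rw [hE] at he hf hg
    rcases he with rfl | he | rfl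
    · rcases hf with rfl | hf | rfl
      · exact absurd hef (hself _)
      · exact absurd hef (hXa' _ hf)
      · rcases hg with rfl | hg | rfl
        · exact absurd heg (hself _)
        · exact absurd heg (hXa' _ hg)
        · rfl
    · rcases hf with rfl | hf | rfl
      · exact absurd hef.symm (hXa' _ he)
      · rcases hg with rfl | hg | rfl
        · exact absurd heg.symm (hXa' _ he)
        · exact h6 e he f hf g hg hef heg
        · exact absurd heg.symm (hXz' _ he)
      · exact absurd hef.symm (hXz' _ he)
    · rcases hf with rfl | hf | rfl
      · rcases hg with rfl | hg | rfl
        · rfl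
        · exact absurd heg (hXz' _ hg)
        · exact absurd heg (hself _)
      · exact absurd hef (hXz' _ hf)
      · exact absurd hef (hself _)

lemma map {c' : ℤ → ℤ} (f : ℤ → ℤ) (h : HasPath c' s t V)
    (hinj : ∀ x y, V x → V y → f x = f y → x = y) (hc : ∀ x, V x → c (f x) = c' x)
    (hX : ∀ x y z w, V x → V y → V z → V w →
      Interleave (f x, f y) (f z, f w) → Interleave (x, y) (z, w))
    (hW : ∀ y, W y ↔ ∃ x, V x ∧ f x = y) : HasPath c (f s) (f t) W := by
  obtain ⟨l, hl⟩ := h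
  exact ⟨_, hl.map f hinj hc hX hW⟩

end HasPath

/-- A discrete intermediate value theorem. -/
lemma exists_first_hit {h : ℤ → ℤ} {a b v : ℤ}
    (hstep : ∀ x, a < x → x ≤ b → h x - h (x - 1) = 1 ∨ h x - h (x - 1) = -1)
    (hab : a ≤ b) (ha : h a < v) (hb : v ≤ h b) :
    ∃ e, a < e ∧ e ≤ b ∧ h e = v ∧ h (e - 1) = v - 1 ∧ ∀ x, a ≤ x → x < e → h x < v := by
  obtain ⟨n, rfl⟩ := Int.le.dest hab
  have hex : ∃ k : ℕ, v ≤ h (a + k) := ⟨n, hb⟩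
  classical
  have hk := Nat.find_spec hex
  have hmin : ∀ j : ℕ, j < Nat.find hex → h (a + j) < v := fun j hj => by
    have := Nat.find_min hex hj
    omega
  have hkn : Nat.find hex ≤ n := Nat.find_min' hex hb
  set k := Nat.find hex with hkdef
  have hk0 : 0 < k := by
    rcases Nat.eq_zero_or_pos k with h0 | h0
    · rw [h0] at hk
      simp at hk
      omega
    · exact h0
  have h1 := hmin (k - 1) (by omega)
  have h2 := hstep (a + k) (by omega) (by omega)
  have h3 : a + ((k - 1 : ℕ) : ℤ) = a + k - 1 := by omega
  rw [h3] at h1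
  refine ⟨a + k, by omega, by omega, by omega, by omega, fun x hx hxk => ?_⟩
  have := hmin (x - a).toNat (by omega)
  rwa [Int.toNat_of_nonneg (by omega), add_sub_cancel] at this

/-- The discrete intermediate value theorem, read from right to left. -/
lemma exists_last_hit {h : ℤ → ℤ} {a b v : ℤ}
    (hstep : ∀ x, a < x → x ≤ b → h x - h (x - 1) = 1 ∨ h x - h (x - 1) = -1)
    (hab : a ≤ b) (hb : h b < v) (ha : v ≤ h a) :
    ∃ e, a ≤ e ∧ e < b ∧ h e = v ∧ h (e + 1) = v - 1 ∧ ∀ x, e < x → x ≤ b → h x < v := by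
  obtain ⟨e, h1, h2, h3, h4, h5⟩ := exists_first_hit (h := fun x => h (-x)) (a := -b) (b := -a)
    (v := v) (fun x hx hx' => by
      have := hstep (-x + 1) (by omega) (by omega)
      have e1 : -x + 1 - 1 = -x := by ring
      have e2 : -(x - 1) = -x + 1 := by ring
      rw [e1] at this
      simp only [e2]
      omega) (by omega) (by simpa) (by simpa)
  refine ⟨-e, by omega, by omega, h3, ?_, fun x hx hx' => ?_⟩
  · rw [← h4]
    congr 1
    ring
  · have := h5 (-x) (by omega) (by omega)
    simpa using this

/-- `h` is a height function on `[a, b]` for the colouring `c` by `1` and `-1`. -/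
def IsHeight (c h : ℤ → ℤ) (a b : ℤ) : Prop :=
  ∀ x, a ≤ x → x ≤ b → (c x = 1 ∨ c x = -1) ∧ h x = h (x - 1) + c x

lemma IsHeight.mono {c h : ℤ → ℤ} {a b a' b' : ℤ} (hh : IsHeight c h a b) (ha : a ≤ a')
    (hb : b' ≤ b) : IsHeight c h a' b' :=
  fun x hx hx' => hh x (ha.trans hx) (hx'.trans hb)

lemma IsHeight.neg {c h : ℤ → ℤ} {a b : ℤ} (hh : IsHeight c h a b) :
    IsHeight (fun x => - c x) (fun x => - h x) a b := by
  intro x hx hx'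
  have := hh x hx hx'
  dsimp only
  omega

lemma IsHeight.step {c h : ℤ → ℤ} {a b : ℤ} (hh : IsHeight c h a b) (x : ℤ) (hx : a < x)
    (hx' : x ≤ b) : h x - h (x - 1) = 1 ∨ h x - h (x - 1) = -1 := by
  have := hh x (by omega) hx'
  omega

/-- A balanced interval whose ends have different colours carries a 1-plane alternating path
joining its ends. -/
theorem hasPath_interval (n : ℕ) : ∀ (c h : ℤ → ℤ) (a b : ℤ), b - a ≤ n → a < b →
    IsHeight c h a b → h b = h (a - 1) → c a ≠ c b →
    HasPath c a b (fun x => a ≤ x ∧ x ≤ b) := by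
  induction n with
  | zero =>
    intro c h a b hn hab
    simp at hn
    omega
  | succ n ih =>
    have key : ∀ (c h : ℤ → ℤ) (a b : ℤ), b - a ≤ (n + 1 : ℕ) → a < b →
        IsHeight c h a b → h b = h (a - 1) → c a = 1 → c b = -1 →
        HasPath c a b (fun x => a ≤ x ∧ x ≤ b) := by
      intro c h a b hn hab hh hbal hca hcb
      have ha := hh a le_rfl hab.le
      have hb := hh b hab.le le_rfl
      push_cast at hn
      rcases eq_or_lt_of_le (Int.add_one_le_iff.2 hab) with h1 | h1
      · refine (HasPath.edge (c := c) (a := a) (b := b) (by omega)).congr fun x => ?_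
        omega
      have ha1 := hh (a + 1) (by omega) (by omega)
      have hb1 := hh (b - 1) (by omega) (by omega)
      rw [add_sub_cancel_right] at ha1
      have hstep := hh.step
      by_cases hc1 : c (a + 1) = -1
      · obtain ⟨e, he1, he2, he3, he4, -⟩ := exists_first_hit (h := h) (a := a + 1) (b := b - 1)
          (v := h a) (fun x hx hx' => hstep x (by omega) (by omega)) (by omega) (by omega)
          (by omega)
        have hce := hh e (by omega) (by omega)
        have p1 : HasPath c a (a + 1) (fun x => x = a ∨ x = a + 1) := HasPath.edge (by omega)
        have p2 := ih c h (a + 1) e (by omega) (by omega) (hh.mono (by omega) (by omega))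
          (by rw [add_sub_cancel_right]; omega) (by omega)
        have p3 := ih c h e b (by omega) (by omega) (hh.mono (by omega) (by omega))
          (by omega) (by omega)
        refine ((p1.trans p2 (by intro x; omega) ?_).trans p3 (by intro x; omega) ?_).congr ?_
        · intro x y z w
          unfold Interleave StrictBtw StrictOut
          omega
        · intro x y z w
          unfold Interleave StrictBtw StrictOut
          omega
        · intro x
          omega
      by_cases hc2 : c (b - 1) = 1
      · obtain ⟨e, he1, he2, he3, he4, -⟩ := exists_last_hit (h := h) (a := a) (b := b - 2)
          (v := h (b - 1)) (fun x hx hx' => hstep x (by omega) (by omega)) (by omega)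
          (by rw [show b - 2 = b - 1 - 1 by ring]; omega) (by omega)
        have hce := hh (e + 1) (by omega) (by omega)
        rw [add_sub_cancel_right] at hce
        have p1 := ih c h a (e + 1) (by omega) (by omega) (hh.mono (by omega) (by omega))
          (by omega) (by omega)
        have p2 := ih c h (e + 1) (b - 1) (by omega) (by omega) (hh.mono (by omega) (by omega))
          (by rw [add_sub_cancel_right]; omega) (by omega)
        have p3 : HasPath c (b - 1) b (fun x => x = b - 1 ∨ x = b) := HasPath.edge (by omega)
        refine ((p1.trans p2 (by intro x; omega) ?_).trans p3 (by intro x; omega) ?_).congr ?_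
        · intro x y z w
          unfold Interleave StrictBtw StrictOut
          omega
        · intro x y z w
          unfold Interleave StrictBtw StrictOut
          omega
        · intro x
          omega
      have hne : a + 1 ≠ b - 1 := fun h => by
        rw [← h] at hc2
        omega
      have p := (ih c h (a + 1) (b - 1) (by omega) (by omega) (hh.mono (by omega) (by omega))
          (by rw [add_sub_cancel_right]; omega) (by omega)).reverse
      refine (p.extend (a := a) (z := b) (by omega) (by omega) (by omega) (by omega) (by omega)
        ?_ ?_).congr ?_
      · intro x y
        unfold Interleave StrictBtw StrictOut
        omega
      · intro x y
        unfold Interleave StrictBtw StrictOut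
        omega
      · intro x
        omega
    intro c h a b hn hab hh hbal hc
    have ha := hh a le_rfl hab.le
    have hb := hh b hab.le le_rfl
    rcases ha.1 with hca | hca
    · exact key c h a b hn hab hh hbal hca (by omega)
    · exact (key _ _ a b hn hab hh.neg (by omega) (by omega) (by omega)).neg

/-- The path of a balanced word consisting of a point `x` followed by the interval `[u, v]`. -/
theorem hasPath_up {c h : ℤ → ℤ} {x u v : ℤ} (hx : x < u ∨ v < x) (huv : u ≤ v)
    (hh : IsHeight c h u v) (hcx : c x = 1 ∨ c x = -1) (hbal : h v + c x = h (u - 1))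
    (hc : c x ≠ c v) :
    HasPath c x v (fun y => y = x ∨ (u ≤ y ∧ y ≤ v)) := by
  have p := hasPath_interval (v - (u - 1)).toNat (fun y => if y = u - 1 then c x else c y)
    (fun y => if y = u - 1 - 1 then h (u - 1) - c x else h y) (u - 1) v (by omega) (by omega) ?_
    ?_ ?_
  · have q := p.map (c := c) (W := fun y => y = x ∨ (u ≤ y ∧ y ≤ v))
      (fun y => if y = u - 1 then x else y) ?_ ?_ ?_ ?_
    · simpa [show v ≠ u - 1 by omega] using q
    · intro y z
      split_ifs <;> omega
    · intro y hy
      split_ifs <;> rfl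
    · intro y z w t hy hz hw ht
      unfold Interleave StrictBtw StrictOut
      dsimp only
      split_ifs <;> omega
    · intro y
      constructor
      · rintro (rfl | hy)
        · exact ⟨u - 1, by omega, by simp⟩
        · exact ⟨y, by omega, by rw [if_neg (by omega)]⟩
      · rintro ⟨z, hz, rfl⟩
        split_ifs <;> omega
  · intro y hy hy'
    have := hh y
    dsimp only
    split_ifs <;> first | omega | (subst_vars; omega)
  · split_ifs <;> omega
  · split_ifs <;> omega

lemma interleave_neg {x y z w : ℤ} :
    Interleave (-x, -y) (-z, -w) ↔ Interleave (x, y) (z, w) := by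
  unfold Interleave StrictBtw StrictOut
  dsimp only
  omega

/-- The path of a balanced word consisting of a point `x` followed by the interval `[u, v]`
read backwards. -/
theorem hasPath_down {c h : ℤ → ℤ} {x u v : ℤ} (hx : x < u ∨ v < x) (huv : u ≤ v)
    (hh : IsHeight c h u v) (hcx : c x = 1 ∨ c x = -1) (hbal : h v + c x = h (u - 1))
    (hc : c x ≠ c u) :
    HasPath c x u (fun y => y = x ∨ (u ≤ y ∧ y ≤ v)) := by
  have p := hasPath_up (c := fun y => c (-y)) (h := fun y => - h (- y - 1)) (x := -x) (u := -v)
    (v := -u) (by omega) (by omega) ?_ (by simpa) ?_ (by simpa)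
  · have q := p.map (c := c) (W := fun y => y = x ∨ (u ≤ y ∧ y ≤ v)) (fun y => -y) ?_ ?_ ?_ ?_
    · simpa using q
    · intro y z _ _
      omega
    · intro y _
      rfl
    · intro y z w t _ _ _ _
      exact interleave_neg.1
    · intro y
      constructor
      · intro hy
        exact ⟨-y, by omega, by simp⟩
      · rintro ⟨z, hz, rfl⟩
        omega
  · intro y hy hy'
    have := hh (-y) (by omega) (by omega)
    dsimp only
    rw [show -(y - 1) - 1 = -y by ring]
    omega
  · rw [show - -u - 1 = u - 1 by ring, show -(-v - 1) - 1 = v by ring, neg_neg]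
    omega

section Circle

variable {c h : ℤ → ℤ} {m p : ℤ}

/-- In a convex polygon with vertices `m, …, p` from which the vertices `i, …, j - 1` have been
removed, both sides between `j` and `p` being balanced and `i - 1` having the colour of `p`. -/
lemma hasPath_of_pred_eq_neg_one (hh : IsHeight c h m p) {i j : ℤ} (hm : m ≤ i - 1) (hij : i ≤ j)
    (hj : j < p) (hcj : c j = 1) (hcp : c p = -1) (hci : c (i - 1) = -1)
    (h₁ : h (p - 1) = h j) (h₂ : h (i - 1) = h (m - 1)) :
    HasPath c j p (fun x => x = j ∨ (j < x ∧ x ≤ p) ∨ (m ≤ x ∧ x < i)) := by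
  have hi := hh (i - 1) hm (by omega)
  have hjj := hh j (by omega) (by omega)
  obtain ⟨e, he1, he2, he3, he4, -⟩ := exists_first_hit (h := h) (a := m - 1) (b := i - 1 - 1)
    (v := h (i - 1) + 1) (fun x hx hx' => by
      have := hh x (by omega) (by omega)
      omega) (by
        by_contra hlt
        have : i - 1 = m - 1 := by omega
        omega) (by omega) (by omega)
  have hce := hh e (by omega) (by omega)
  have p1 := (hasPath_down (c := c) (h := h) (x := i - 1) (u := j) (v := p - 1) (by omega)
    (by omega) (hh.mono (by omega) (by omega)) (by omega) (by omega) (by omega)).reverse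
  have p2 := (hasPath_interval (i - 1 - e).toNat c h e (i - 1) (by omega) (by omega)
    (hh.mono (by omega) (by omega)) (by omega) (by omega)).reverse
  have p3 := (hasPath_up (c := c) (h := h) (x := p) (u := m) (v := e) (by omega)
    (by omega) (hh.mono (by omega) (by omega)) (by omega) (by omega) (by omega)).reverse
  refine ((p1.trans p2 (by intro x; omega) ?_).trans p3 (by intro x; omega) ?_).congr ?_
  · intro x y z w
    unfold Interleave StrictBtw StrictOut
    omega
  · intro x y z w
    unfold Interleave StrictBtw StrictOut
    omega
  · intro x
    omega

lemma hasPath_zigzag (hh : IsHeight c h m p) {i j x y ρ : ℤ} (hx : m ≤ x) (hxi : x ≤ i - 1)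
    (hij : i ≤ j) (hy : j < y) (hyp : y < p) (hρ : ρ = i ∨ ρ = j) (hcρ : c ρ = 1)
    (hcx : c x = -1) (hcy : c y = 1) (h₁ : h x = h (i - 1)) (h₂ : h (y - 1) = h j)
    (hrest : HasPath c y p (fun z => z = y ∨ (y < z ∧ z ≤ p) ∨ (m ≤ z ∧ z < x))) :
    HasPath c ρ p (fun z => z = ρ ∨ (j < z ∧ z ≤ p) ∨ (m ≤ z ∧ z < i)) := by
  have hhx := hh x hx (by omega)
  have hhy := hh y (by omega) (by omega)
  have p1 := hasPath_down (c := c) (h := h) (x := ρ) (u := x) (v := i - 1) (by omega)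
    (by omega) (hh.mono (by omega) (by omega)) (by omega) (by omega) (by omega)
  have p2 := hasPath_up (c := c) (h := h) (x := x) (u := j + 1) (v := y) (by omega)
    (by omega) (hh.mono (by omega) (by omega)) (by omega)
    (by rw [add_sub_cancel_right]; omega) (by omega)
  refine ((p1.trans p2 (by intro x; omega) ?_).trans hrest (by intro x; omega) ?_).congr ?_
  · intro x y z w
    unfold Interleave StrictBtw StrictOut
    omega
  · intro x y z w
    unfold Interleave StrictBtw StrictOut
    omega
  · intro x
    omega

/-- The case of a positive imbalance on the side `(j, p)`. -/
lemma hasPath_of_imbalance (hh : IsHeight c h m p) (hcp : c p = -1) (s : ℕ) :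
    ∀ {i j ρ : ℤ}, m ≤ i → i ≤ j → j < p → (ρ = i ∨ ρ = j) → c ρ = 1 →
      h (p - 1) = h j + s + 1 → h (m - 1) = h (i - 1) + s + 1 →
      HasPath c ρ p (fun z => z = ρ ∨ (j < z ∧ z ≤ p) ∨ (m ≤ z ∧ z < i)) := by
  have hup : ∀ {j : ℤ}, m ≤ j → j < p → h j < h (p - 1) →
      ∃ y, j < y ∧ y < p ∧ h (y - 1) = h j ∧ h y = h j + 1 ∧ c y = 1 := by
    intro j hmj hj hlt
    obtain ⟨y, hy1, hy2, hy3, hy4, -⟩ := exists_first_hit (h := h) (a := j) (b := p - 1)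
      (v := h j + 1) (fun x hx hx' => by
        have := hh x (by omega) (by omega)
        omega) (by omega) (by omega) (by omega)
    have := hh y (by omega) (by omega)
    exact ⟨y, hy1, by omega, by omega, by omega, by omega⟩
  induction s with
  | zero =>
    intro i j ρ hmi hij hjp hρ hcρ h₁ h₂
    obtain ⟨y, hy1, hy2, hy3, hy4, hcy⟩ := hup (by omega) hjp (by omega)
    have hmi' : m ≤ i - 1 := by
      by_contra hlt
      have : i = m := by omega
      subst this
      omega
    have hhm := hh m le_rfl (by omega)
    by_cases hcm : c m = -1
    · refine hasPath_zigzag hh le_rfl hmi' hij hy1 hy2 hρ hcρ hcm hcy (by omega) hy3 ?_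
      refine (hasPath_interval (p - y).toNat c h y p (by omega) (by omega)
        (hh.mono (by omega) le_rfl) ?_ (by omega)).congr fun z => by omega
      have := hh p (by omega) le_rfl
      omega
    · obtain ⟨e, he1, he2, he3, he4, hlt⟩ := exists_last_hit (h := h) (a := m) (b := i - 1)
        (v := h (i - 1) + 2) (fun x hx hx' => by
          have := hh x (by omega) (by omega)
          omega) (by omega) (by omega) (by omega)
      have hne : e + 1 ≠ i - 1 := fun heq => by
        rw [heq] at he4
        omega
      have hhe := hh (e + 1) (by omega) (by omega)
      have hhe2 := hh (e + 2) (by omega) (by omega)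
      have hlt2 := hlt (e + 2) (by omega) (by omega)
      rw [show e + 1 - 1 = e by ring] at hhe
      rw [show e + 2 - 1 = e + 1 by ring] at hhe2
      refine hasPath_zigzag hh (x := e + 2) (by omega) (by omega) hij hy1 hy2 hρ hcρ (by omega)
        hcy (by omega) hy3 ?_
      refine hasPath_of_pred_eq_neg_one hh (by omega) (by omega) (by omega) hcy hcp ?_ (by omega)
        ?_
      · rw [show e + 2 - 1 = e + 1 by ring]
        omega
      · rw [show e + 2 - 1 = e + 1 by ring]
        omega
  | succ s ih =>
    intro i j ρ hmi hij hjp hρ hcρ h₁ h₂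
    push_cast at h₁ h₂
    obtain ⟨y, hy1, hy2, hy3, hy4, hcy⟩ := hup (by omega) hjp (by omega)
    have hmi' : m ≤ i - 1 := by
      by_contra hlt
      have : i = m := by omega
      subst this
      omega
    obtain ⟨e, he1, he2, he3, he4, hlt⟩ := exists_last_hit (h := h) (a := m - 1) (b := i - 1)
      (v := h (i - 1) + 1) (fun x hx hx' => by
        have := hh x (by omega) (by omega)
        omega) (by omega) (by omega) (by omega)
    have hhe := hh (e + 1) (by omega) (by omega)
    rw [show e + 1 - 1 = e by ring] at hhe
    refine hasPath_zigzag hh (x := e + 1) (by omega) (by omega) hij hy1 hy2 hρ hcρ (by omega)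
      hcy (by omega) hy3 ?_
    refine ih (by omega) (by omega) (by omega) (Or.inr rfl) hcy (by omega) ?_
    rw [show e + 1 - 1 = e by ring]
    omega

/-- The special configurations: both sides between `0` and `p` are nonempty balanced words none
of whose initial segments, read from `0`, has more points of the colour of `p`. -/
def SpecialHeights (h : ℤ → ℤ) (m p : ℤ) : Prop :=
  1 < p ∧ m < 0 ∧ h (p - 1) = h 0 ∧ (∀ x, 0 ≤ x → x < p → h 0 ≤ h x) ∧
    ∀ x, m ≤ x → x ≤ 0 → h (x - 1) ≤ h (-1)

lemma hasPath_of_half (hh : IsHeight c h m p) (hm : m ≤ 0) (hp : 0 < p) (hc0 : c 0 = 1)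
    (hcp : c p = -1) (hbal : h p = h (m - 1))
    (hcase : h 0 < h (p - 1) ∨ m = 0 ∨ (h (p - 1) = h 0 ∧ ∃ x, 0 < x ∧ x < p ∧ h x < h 0)) :
    HasPath c 0 p (fun x => m ≤ x ∧ x ≤ p) := by
  have h0 := hh 0 hm hp.le
  have hhp := hh p (by omega) le_rfl
  rw [zero_sub] at h0
  by_cases hm0 : m = 0
  · subst hm0
    exact hasPath_interval p.toNat c h 0 p (by omega) hp hh hbal (by omega)
  rcases hcase with hlt | h0' | ⟨heq, x, hx0, hxp, hx⟩
  · refine (hasPath_of_imbalance hh hcp (h (p - 1) - h 0 - 1).toNat hm le_rfl hp (Or.inl rfl) hc0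
      (by omega) (by rw [zero_sub]; omega)).congr fun z => by omega
  · exact absurd h0' hm0
  by_cases hc1 : c (-1) = -1
  · refine (hasPath_of_pred_eq_neg_one hh (i := 0) (j := 0) (by omega) le_rfl hp hc0 hcp
      (by simpa using hc1) heq (by rw [zero_sub]; omega)).congr fun z => by omega
  have hh1 := hh (-1) (by omega) (by omega)
  rw [show (-1 - 1 : ℤ) = -2 by norm_num] at hh1
  obtain ⟨e, he1, he2, he3, he4, -⟩ := exists_first_hit (h := fun y => - h y) (a := 0) (b := x)
    (v := - h 0 + 1) (fun y hy hy' => by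
      have := hh y (by omega) (by omega)
      omega) (by omega) (by omega) (by omega)
  have hhe := hh e (by omega) (by omega)
  have p1 := hasPath_interval e.toNat c h 0 e (by omega) (by omega)
    (hh.mono (by omega) (by omega)) (by rw [zero_sub]; omega) (by omega)
  have p2 : HasPath c e (-1) (fun z => z = e ∨ z = -1) := HasPath.edge (by omega)
  have p3 := hasPath_of_imbalance hh hcp 0 (i := -1) (j := e) (ρ := -1) (by omega) (by omega)
    (by omega) (Or.inl rfl) (by omega) (by push_cast; omega) (by push_cast; omega)
  refine ((p1.trans p2 (by intro x; omega) ?_).trans p3 (by intro x; omega) ?_).congr ?_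
  · intro x y z w
    unfold Interleave StrictBtw StrictOut
    omega
  · intro x y z w
    unfold Interleave StrictBtw StrictOut
    omega
  · intro x
    omega

/-- The orientation-reversing relabelling of the vertices `1 - p, …, 1 - m` by `m, …, p` that
fixes `0` and sends the last label to the last label. -/
def flipIdx (m p : ℤ) (y : ℤ) : ℤ := if y = 1 - m then p else -y

lemma IsAltPath.flip {c' : ℤ → ℤ} {s t : ℤ} {l : List ℤ}
    (h : IsAltPath c s t (fun x => 1 - p ≤ x ∧ x ≤ 1 - m) l)
    (hc : ∀ x, 1 - p ≤ x → x ≤ 1 - m → c' (flipIdx m p x) = c x) :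
    IsAltPath c' (flipIdx m p s) (flipIdx m p t) (fun x => m ≤ x ∧ x ≤ p) (l.map (flipIdx m p)) := by
  refine h.map (flipIdx m p) ?_ (fun x hx => hc x hx.1 hx.2) ?_ ?_
  · intro x y _ _
    unfold flipIdx
    split_ifs <;> omega
  · intro x y z w hx hy hz hw
    unfold Interleave StrictBtw StrictOut flipIdx
    dsimp only
    split_ifs <;> omega
  · intro y
    constructor
    · intro hy
      by_cases hyp : y = p
      · exact ⟨1 - m, by omega, by simp [flipIdx, hyp]⟩
      · exact ⟨-y, by omega, by unfold flipIdx; rw [if_neg (by omega)]; omega⟩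
    · rintro ⟨z, hz, rfl⟩
      unfold flipIdx
      split_ifs <;> omega

/-- The height function of the reversed colouring `c ∘ flipIdx m p`. -/
def flipHeight (h : ℤ → ℤ) (m : ℤ) (y : ℤ) : ℤ :=
  if y = 1 - m then - h (m - 1) - 1 else - h (-y - 1)

lemma IsHeight.flip (hh : IsHeight c h m p) (hcp : c p = -1) :
    IsHeight (fun y => c (flipIdx m p y)) (flipHeight h m) (1 - p) (1 - m) := by
  intro y hy hy'
  unfold flipHeight flipIdx
  by_cases hym : y = 1 - m
  · subst hym
    refine ⟨Or.inr (by simp [hcp]), ?_⟩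
    dsimp only
    rw [if_pos rfl, if_neg (show (1 - m - 1 : ℤ) ≠ 1 - m by omega), if_pos rfl,
      show -(1 - m - 1) - 1 = m - 1 by ring, hcp]
    ring
  · have := hh (-y) (by omega) (by omega)
    simp only [if_neg hym, if_neg (show y - 1 ≠ 1 - m by omega)]
    rw [show -(y - 1) - 1 = -y by ring]
    omega

lemma specialHeights_flipHeight (hm : m ≤ 0) (h0 : h 0 = h (-1) + 1)
    (hhp : h p = h (p - 1) - 1) (hbal : h p = h (m - 1)) :
    SpecialHeights (flipHeight h m) (1 - p) (1 - m) ↔ SpecialHeights h m p := by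
  unfold SpecialHeights flipHeight
  rw [if_neg (show (0 : ℤ) ≠ 1 - m by omega), if_neg (show (1 - m - 1 : ℤ) ≠ 1 - m by omega),
    if_neg (show (-1 : ℤ) ≠ 1 - m by omega), show -(1 - m - 1) - 1 = m - 1 by ring,
    show (-0 - 1 : ℤ) = -1 by ring, show (- -1 - 1 : ℤ) = 0 by ring]
  constructor
  · rintro ⟨k1, k2, k3, k4, k5⟩
    refine ⟨by omega, by omega, by omega, fun x hx hxp => ?_, fun x hx hxp => ?_⟩
    · have := k5 (-x) (by omega) (by omega)
      rw [if_neg (by omega), show -(-x - 1) - 1 = x by ring] at this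
      omega
    · have := k4 (-x) (by omega) (by omega)
      rw [if_neg (by omega), neg_neg] at this
      omega
  · rintro ⟨k1, k2, k3, k4, k5⟩
    refine ⟨by omega, by omega, by omega, fun x hx hxp => ?_, fun x hx hxp => ?_⟩
    · have := k5 (-x) (by omega) (by omega)
      rw [if_neg (by omega)]
      omega
    · have := k4 (-x) (by omega) (by omega)
      rw [if_neg (by omega), show -(x - 1) - 1 = -x by ring]
      omega

/-- A non-special circular word carries a 1-plane alternating path. -/
theorem hasPath_of_not_specialHeights (hh : IsHeight c h m p) (hm : m ≤ 0) (hp : 0 < p)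
    (hc0 : c 0 = 1) (hcp : c p = -1) (hbal : h p = h (m - 1)) (hns : ¬ SpecialHeights h m p) :
    HasPath c 0 p (fun x => m ≤ x ∧ x ≤ p) := by
  have h0 := hh 0 hm hp.le
  have hhp := hh p (by omega) le_rfl
  rw [zero_sub] at h0
  by_cases hcase : h 0 < h (p - 1) ∨ m = 0 ∨
      (h (p - 1) = h 0 ∧ ∃ x, 0 < x ∧ x < p ∧ h x < h 0)
  · exact hasPath_of_half hh hm hp hc0 hcp hbal hcase
  have hf0 : flipIdx m p 0 = 0 := by
    unfold flipIdx
    rw [if_neg (by omega), neg_zero]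
  have hfp : flipIdx m p (1 - m) = p := if_pos rfl
  suffices hflip : HasPath (fun y => c (flipIdx m p y)) 0 (1 - m)
      (fun x => 1 - p ≤ x ∧ x ≤ 1 - m) by
    obtain ⟨l, hl⟩ := hflip
    have := hl.flip (c' := c) fun x _ _ => rfl
    rw [hf0, hfp] at this
    exact ⟨_, this⟩
  refine hasPath_of_half (hh.flip hcp) (by omega) (by omega) (by rwa [hf0]) (by rwa [hfp]) ?_ ?_
  · unfold flipHeight
    rw [if_pos rfl, if_neg (by omega), show -(1 - p - 1) - 1 = p - 1 by ring]
    omega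
  · by_contra hcon
    refine hns ?_
    unfold flipHeight at hcon
    rw [if_neg (show (0 : ℤ) ≠ 1 - m by omega), if_neg (show (1 - m - 1 : ℤ) ≠ 1 - m by omega),
      show -(1 - m - 1) - 1 = m - 1 by ring, show (-0 - 1 : ℤ) = -1 by ring] at hcon
    push Not at hcon hcase
    obtain ⟨g1, g2, g3⟩ := hcase
    obtain ⟨k1, k2, k3⟩ := hcon
    have heq : h (p - 1) = h 0 := by omega
    refine ⟨by omega, by omega, heq, fun x hx hxp => ?_, fun x hx hxp => ?_⟩
    · rcases eq_or_lt_of_le hx with rfl | hx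
      · exact le_rfl
      · exact g3 heq x hx hxp
    · rcases eq_or_lt_of_le hxp with rfl | hxp
      · simp
      · have := k3 (by omega) (-x) (by omega) (by omega)
        rw [if_neg (by omega), neg_neg] at this
        omega

end Circle

section Converse

variable {c h : ℤ → ℤ} {m p : ℤ}

lemma mem_consec_cons {α : Type*} {e : α × α} {l : List α} (a : α) (he : e ∈ consec l) :
    e ∈ consec (a :: l) := by
  cases l with
  | nil => simp at he
  | cons b l => exact List.mem_cons_of_mem _ he

lemma mem_consec_append_left {α : Type*} {e : α × α} {l : List α} (he : e ∈ consec l)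
    (l' : List α) : e ∈ consec (l ++ l') := by
  induction l with
  | nil => simp at he
  | cons a l ih =>
    cases l with
    | nil => simp at he
    | cons b l =>
      rcases List.mem_cons.1 he with rfl | he
      · simp
      · exact mem_consec_cons _ (ih he)

lemma alternating_sum : ∀ (l : List ℤ) (a z : ℤ), (∀ x ∈ a :: l, c x = 1 ∨ c x = -1) →
    (∀ e ∈ consec (a :: l), c e.1 ≠ c e.2) → (a :: l).getLast? = some z →
    (((a :: l).map c).sum = c a ∧ c z = c a) ∨ (((a :: l).map c).sum = 0 ∧ c z = - c a)
  | [], a, z, _, _, hz => by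
    simp at hz
    simp [hz]
  | b :: l, a, z, hc, halt, hz => by
    have hab := halt (a, b) (by simp)
    have ha := hc a (by simp)
    have hb := hc b (by simp)
    have := alternating_sum l b z (fun x hx => hc x (List.mem_cons_of_mem _ hx))
      (fun e he => halt e (by simp [he])) (by simpa using hz)
    rw [List.map_cons, List.sum_cons]
    dsimp only at hab
    omega

lemma IsHeight.sum_Ioc {a b : ℤ} (hab : a ≤ b) (hh : IsHeight c h (a + 1) b) :
    ∑ y ∈ Finset.Ioc a b, c y = h b - h a := by
  induction b, hab using Int.leInduction with
  | base => simp
  | succ b hab ih =>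
    have hins : Finset.Ioc a (b + 1) = insert (b + 1) (Finset.Ioc a b) := by
      ext x
      simp only [Finset.mem_Ioc, Finset.mem_insert]
      omega
    rw [hins, Finset.sum_insert (by simp), ih fun x hx hx' => hh x hx (by omega)]
    have := (hh (b + 1) (by omega) le_rfl).2
    rw [add_sub_cancel_right] at this
    omega

lemma exists_maximal_prefix {α : Type*} (Q : α → Prop) (l : List α) :
    ∃ P D, l = P ++ D ∧ (∀ x ∈ P, Q x) ∧ ∀ y D', D = y :: D' → ¬ Q y := by
  induction l with
  | nil => exact ⟨[], [], by simp⟩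
  | cons a l ih =>
    by_cases ha : Q a
    · obtain ⟨P, D, rfl, hP, hD⟩ := ih
      exact ⟨a :: P, D, rfl, by simpa [ha] using hP, hD⟩
    · refine ⟨[], a :: l, rfl, by simp, fun y D' h => ?_⟩
      rw [List.cons.injEq] at h
      exact h.1 ▸ ha

lemma not_isAltPath_of_pos (hh : IsHeight c h m p) (hc0 : c 0 = 1)
    (hs : SpecialHeights h m p) {x : ℤ} {T : List ℤ} (hx : 0 < x) :
    ¬ IsAltPath c 0 p (fun x => m ≤ x ∧ x ≤ p) (0 :: x :: T) := by
  rintro ⟨-, hlast, hnd, hV, halt, hone⟩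
  obtain ⟨hp1, hm0, -, hs4, hs5⟩ := hs
  have hneg : (-1 : ℤ) ∈ (0 :: x :: T) := (hV _).2 (by omega)
  have hpl : p ∈ (0 :: x :: T) := (hV _).2 (by omega)
  have hxp : x ≤ p := ((hV x).1 (by simp)).2
  have hxT : x ∉ T := by
    rw [List.nodup_cons, List.nodup_cons] at hnd
    exact hnd.2.1
  have hxp : x < p := by
    rcases hxp.lt_or_eq with h | rfl
    · exact h
    rcases List.eq_nil_or_concat T with rfl | ⟨T', t, rfl⟩
    · simp at hneg
      omega
    · rw [List.concat_eq_append, ← List.cons_append, ← List.cons_append, List.getLast?_append] at hlast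
      simp at hlast
      simp [hlast] at hxT
  obtain ⟨P, D, rfl, hP, hD⟩ := exists_maximal_prefix (fun y => 0 < y ∧ y < x) T
  have hpD : p ∈ D := by
    simp only [List.mem_cons, List.mem_append] at hpl
    rcases hpl with h | h | h | h
    · omega
    · omega
    · have := hP p h
      omega
    · exact h
  obtain ⟨y, D', rfl⟩ := List.exists_cons_of_ne_nil (List.ne_nil_of_mem hpD)
  have hy := hD y D' rfl
  have hnd' : ∀ a ∈ y :: D', a ≠ 0 ∧ a ≠ x ∧ a ∉ P := by
    intro a ha
    rw [List.nodup_cons, List.nodup_cons] at hnd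
    refine ⟨?_, ?_, ?_⟩
    · rintro rfl
      exact hnd.1 (by simp only [List.mem_cons, List.mem_append] at ha ⊢; tauto)
    · rintro rfl
      exact hnd.2.1 (by simp only [List.mem_cons, List.mem_append] at ha ⊢; tauto)
    · exact fun haP => (List.nodup_append.1 hnd.2.2).2.2 a haP a ha rfl
  have hcons : consec (0 :: x :: (P ++ y :: D')) =
      consec (0 :: x :: (P ++ [y])) ++ consec (y :: D') :=
    consec_append_cons (0 :: x :: P) y D'
  have hDl : ∀ e ∈ consec (y :: D'), e ∈ consec (0 :: x :: (P ++ y :: D')) := fun e he => by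
    rw [hcons]
    exact List.mem_append_right _ he
  have hlastD : (y :: D').getLast? = some p := by
    have : (0 :: x :: P ++ y :: D').getLast? = some p := hlast
    rwa [List.getLast?_append_of_ne_nil _ (by simp)] at this
  have h0x : ((0 : ℤ), x) ∈ consec (0 :: x :: (P ++ y :: D')) := by simp
  have hDw : ∀ a ∈ y :: D', ¬ (0 < a ∧ a < x) := by
    intro a ha haw
    obtain ⟨e, he, he1, he2⟩ := exists_consec_entering (Q := fun y => 0 < y ∧ y < x) ha haw rfl hy
    obtain ⟨f, hf, hf1, hf2⟩ := exists_consec_leaving (Q := fun y => 0 < y ∧ y < x) ha haw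
      hlastD (by omega)
    have he' := hnd' _ (mem_of_mem_consec he).1
    have hf' := hnd' _ (mem_of_mem_consec hf).2
    have := hone _ h0x e (hDl e he) f (hDl f hf)
      (by unfold Interleave StrictBtw StrictOut; omega)
      (by unfold Interleave StrictBtw StrictOut; omega)
    subst this
    exact he1 hf1
  have hPw : ∀ a, a ∈ P ↔ 0 < a ∧ a < x := by
    refine fun a => ⟨hP a, fun ha => ?_⟩
    have : a ∈ 0 :: x :: (P ++ y :: D') := (hV a).2 (by omega)
    rw [List.mem_cons, List.mem_cons, List.mem_append] at this
    rcases this with h | h | h | h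
    · omega
    · omega
    · exact h
    · exact absurd ha (hDw a h)
  have hcx : c x = -1 := by
    have h1 := (hh x (by omega) (by omega)).1
    have h2 := halt (0, x) h0x
    simp only [hc0] at h2
    omega
  have hhx := (hh x (by omega) (by omega)).2
  have hx0 := hs4 x (by omega) hxp
  have hsum : (P.map c).sum = h (x - 1) - h 0 := by
    rw [← IsHeight.sum_Ioc (c := c) (by omega) (fun y hy hy' => hh y (by omega) (by omega)),
      ← List.sum_toFinset c (hnd.sublist ((List.sublist_append_left P (y :: D')).trans
        ((List.sublist_cons_self x _).trans (List.sublist_cons_self 0 _))))]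
    refine Finset.sum_congr ?_ fun _ _ => rfl
    ext a
    rw [List.mem_toFinset, hPw, Finset.mem_Ioc]
    omega
  rcases List.eq_nil_or_concat P with rfl | ⟨P₀, z, hPz⟩
  · rw [List.map_nil, List.sum_nil] at hsum
    omega
  have hPne : P ≠ [] := by simp [hPz]
  obtain ⟨z', P', rfl⟩ := List.exists_cons_of_ne_nil hPne
  have hz' : c z' = 1 := by
    have h1 := (hh z' (by have := hP z' (by simp); omega)
      (by have := hP z' (by simp); omega)).1
    have h2 := halt (x, z') (by simp)
    simp only [hcx] at h2
    omega
  have hzy : (z, y) ∈ consec (0 :: x :: (z' :: P' ++ y :: D')) := by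
    rw [hcons, hPz]
    have := consec_append_cons (0 :: x :: P₀) z [y]
    simp only [List.cons_append, List.append_assoc, List.concat_eq_append,
      List.nil_append] at this ⊢
    simp [this]
  have hz : z ∈ z' :: P' := by simp [hPz]
  have hzw := hP z hz
  have hyV := (hV y).1 (by simp)
  have hy' := hnd' y (by simp)
  have hcz : c z = 1 ∧ h x = h 0 := by
    have := alternating_sum P' z' z (c := c)
      (fun a ha => (hh a (by have := hP a ha; omega) (by have := hP a ha; omega)).1)
      (fun e he => halt e (mem_consec_cons _ (mem_consec_cons _ (mem_consec_append_left he _))))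
      (by simp [hPz])
    omega
  have hcy : c y = -1 := by
    have h1 := (hh y hyV.1 hyV.2).1
    have h2 := halt _ hzy
    simp only [hcz] at h2
    omega
  have hno : ∀ e ∈ consec (y :: D'), ¬ Interleave (z, y) e := by
    intro e he hI
    have := hone _ hzy _ h0x e (hDl e he) (by unfold Interleave StrictBtw StrictOut; omega) hI
    exact (hnd' _ (mem_of_mem_consec he).1).1 (by rw [← this])
  have hndD : y ∉ D' := by
    have := hnd.sublist (List.sublist_append_right (0 :: x :: z' :: P') (y :: D'))
    exact (List.nodup_cons.1 this).1
  have hmemD : ∀ a, m ≤ a → a ≤ p → (a < 0 ∨ x < a) → a = y ∨ a ∈ D' := by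
    intro a ha ha' hax
    have h1 : a ∈ 0 :: x :: (z' :: P' ++ y :: D') := (hV a).2 ⟨ha, ha'⟩
    have h2 := hPw a
    simp only [List.mem_cons, List.mem_append] at h1 h2
    by_cases hay : a = y
    · exact Or.inl hay
    · by_cases haD : a ∈ D'
      · exact Or.inr haD
      · exfalso
        have hax' : a ≠ 0 ∧ a ≠ x := by omega
        have : ¬ (a = z' ∨ a ∈ P') := fun h => by have := h2.1 h; omega
        tauto
  have hpD' : y ≠ p → D'.getLast? = some p := by
    intro hyp
    have h1 : p ∈ D' := by
      rcases hmemD p (by omega) le_rfl (by omega) with h | h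
      · exact absurd h.symm hyp
      · exact h
    rwa [← List.singleton_append, List.getLast?_append_of_ne_nil _ (List.ne_nil_of_mem h1)]
      at hlastD
  have key : ∀ (Q : ℤ → Prop) (a : ℤ), a ∈ D' → Q a → ¬ Q p → y ≠ p →
      ∃ e ∈ consec (y :: D'), Q e.1 ∧ ¬ Q e.2 ∧ e.2 ≠ y ∧ e.2 ≠ 0 ∧ e.2 ≠ x ∧
        ¬ (0 < e.2 ∧ e.2 < x) := by
    intro Q a ha hQ hQp hyp
    obtain ⟨e, he, he1, he2⟩ := exists_consec_leaving ha hQ (hpD' hyp) hQp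
    have heD := (mem_of_mem_consec he).2
    have h1 := hnd' e.2 (List.mem_cons_of_mem _ heD)
    have h2 := hDw e.2 (List.mem_cons_of_mem _ heD)
    exact ⟨e, mem_consec_cons _ he, he1, he2, fun h => hndD (h ▸ heD), h1.1, h1.2.1, h2⟩
  rcases lt_trichotomy y p with hyp | rfl | hyp
  · by_cases hy0 : y < 0
    · rcases hmemD (-1) (by omega) (by omega) (by omega) with h | h
      · subst h
        have h1 := (hh (-1) (by omega) (by omega)).2
        have h2 := hs5 (-1) (by omega) (by omega)
        omega
      · by_cases hy1 : y = -1
        · exact hndD (hy1 ▸ h)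
        obtain ⟨e, he, h1⟩ := key (fun a => y < a ∧ a < 0) (-1) h (by omega) (by omega) (by omega)
        exact hno e he (by unfold Interleave StrictBtw StrictOut; omega)
    · rcases hmemD (x + 1) (by omega) (by omega) (by omega) with h | h
      · subst h
        have h1 := (hh (x + 1) (by omega) (by omega)).2
        have h2 := hs4 (x + 1) (by omega) (by omega)
        rw [add_sub_cancel_right] at h1
        omega
      · by_cases hy1 : y = x + 1
        · exact hndD (hy1 ▸ h)
        obtain ⟨e, he, h1⟩ := key (fun a => x < a ∧ a < y) (x + 1) h (by omega) (by omega)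
          (by omega)
        exact hno e he (by unfold Interleave StrictBtw StrictOut; omega)
  · rcases hmemD (-1) (by omega) (by omega) (by omega) with h | h
    · omega
    · rcases List.eq_nil_or_concat D' with rfl | ⟨D'', t, rfl⟩
      · simp at h
      · rw [List.concat_eq_append, ← List.cons_append, List.getLast?_append] at hlastD
        simp at hlastD
        simp [hlastD] at hndD
  · omega

/-- A special circular word carries no 1-plane alternating path. -/
theorem not_hasPath_of_specialHeights (hh : IsHeight c h m p) (hc0 : c 0 = 1) (hcp : c p = -1)
    (hbal : h p = h (m - 1)) (hs : SpecialHeights h m p) :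
    ¬ HasPath c 0 p (fun x => m ≤ x ∧ x ≤ p) := by
  rintro ⟨l, hl⟩
  have hp := hs.1
  have hm := hs.2.1
  have h0 := hh 0 (by omega) (by omega)
  have hhp := hh p (by omega) le_rfl
  rw [zero_sub] at h0
  obtain ⟨h1, h2, h3, h4, h5⟩ := id hl
  match l, h1 with
  | [_], h1 =>
    simp at h1 h2
    omega
  | a :: x :: T, h1 =>
    obtain rfl : a = 0 := by simpa using h1
    rcases lt_trichotomy x 0 with hx | rfl | hx
    · have hmx := (h4 x).1 (by simp)
      have hl₂ : IsAltPath c 0 p (fun x => 1 - (1 - m) ≤ x ∧ x ≤ 1 - (1 - p)) (0 :: x :: T) := by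
        simpa only [sub_sub_cancel] using hl
      have hl₃ := hl₂.flip (c' := fun y => c (flipIdx m p y)) (by
        intro y hy hy'
        congr 1
        unfold flipIdx
        split_ifs <;> omega)
      have e0 : flipIdx (1 - p) (1 - m) 0 = 0 := by simp [flipIdx, show (0 : ℤ) ≠ p by omega]
      have ep : flipIdx (1 - p) (1 - m) p = 1 - m := by simp [flipIdx]
      have ex : flipIdx (1 - p) (1 - m) x = -x := by simp [flipIdx, show x ≠ p by omega]
      rw [List.map_cons, List.map_cons, e0, ep, ex] at hl₃
      refine not_isAltPath_of_pos (hh.flip hcp) ?_ ?_ (by omega) hl₃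
      · simp [flipIdx, hc0, show (0 : ℤ) ≠ 1 - m by omega]
      · exact (specialHeights_flipHeight (by omega) (by omega) (by omega) hbal).2 hs
    · simp at h3
    · exact not_isAltPath_of_pos hh hc0 hs hx hl

end Converse

section Geometry

lemma det2_rotate (a b c : Pt) : det2 b c a = det2 a b c := by
  unfold det2
  ring

lemma det2_swap (a b c : Pt) : det2 a c b = - det2 a b c := by
  unfold det2
  ring

lemma segCross_swap_left {e f : Pt × Pt} : SegCross e.swap f ↔ SegCross e f := by
  unfold SegCross
  rw [Prod.fst_swap, Prod.snd_swap, openSegment_symm]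

lemma segCross_swap_right {e f : Pt × Pt} : SegCross e f.swap ↔ SegCross e f := by
  unfold SegCross
  rw [Prod.fst_swap, Prod.snd_swap, openSegment_symm ℝ f.2]

lemma segCross_of_convex_quadrilateral {a b c d : Pt} (h₁ : 0 < det2 a c b) (h₂ : 0 < det2 a b d)
    (h₃ : 0 < det2 c b d) (h₄ : 0 < det2 a c d) : SegCross (a, b) (c, d) := by
  have hsum : det2 c b d + det2 a c d = det2 a c b + det2 a b d := by
    unfold det2
    ring
  have hD : 0 < det2 a c b + det2 a b d := by positivity
  refine ⟨(det2 a b d / (det2 a c b + det2 a b d)) • c +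
    (det2 a c b / (det2 a c b + det2 a b d)) • d, ?_, ?_⟩
  · refine ⟨det2 c b d / (det2 a c b + det2 a b d), det2 a c d / (det2 a c b + det2 a b d),
      by positivity, by positivity, ?_, ?_⟩
    · rw [← add_div, hsum, div_self hD.ne']
    · ext <;> simp only [Prod.fst_add, Prod.snd_add, Prod.smul_fst, Prod.smul_snd, smul_eq_mul,
        div_mul_eq_mul_div, ← add_div] <;> congr 1 <;> unfold det2 <;> ring
  · exact ⟨_, _, by positivity, by positivity, by rw [← add_div, add_comm, div_self hD.ne'], rfl⟩

lemma not_segCross_of_nonneg {a b c d : Pt} (hc : 0 ≤ det2 a b c) (hd : 0 ≤ det2 a b d)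
    (hcd : 0 < det2 a b c + det2 a b d) : ¬ SegCross (a, b) (c, d) := by
  rintro ⟨_, ⟨s, t, hs, ht, hst, rfl⟩, ⟨u, v, hu, hv, huv, hx⟩⟩
  have h₁ := congrArg Prod.fst hx
  have h₂ := congrArg Prod.snd hx
  simp only [Prod.fst_add, Prod.snd_add, Prod.smul_fst, Prod.smul_snd, smul_eq_mul] at h₁ h₂
  have key : u * det2 a b c + v * det2 a b d = 0 := by
    obtain rfl : s = 1 - t := by linarith
    obtain rfl : u = 1 - v := by linarith
    unfold det2
    linear_combination (b.1 - a.1) * h₂ - (b.2 - a.2) * h₁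
  rcases hc.lt_or_eq with h | h
  · nlinarith [mul_pos hu h, mul_nonneg hv.le hd]
  · have : 0 < det2 a b d := by linarith
    nlinarith [mul_pos hv this, mul_nonneg hu.le hc]

lemma not_segCross_of_nonpos {a b c d : Pt} (hc : det2 a b c ≤ 0) (hd : det2 a b d ≤ 0)
    (hcd : det2 a b c + det2 a b d < 0) : ¬ SegCross (a, b) (c, d) := by
  have key : ∀ x, det2 b a x = - det2 a b x := fun x => by
    unfold det2
    ring
  rw [← segCross_swap_left]
  exact not_segCross_of_nonneg (by rw [key]; linarith) (by rw [key]; linarith)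
    (by rw [key, key]; linarith)

/-- `f` labels the points of `S` in counterclockwise convex order by the integers of `[m, p]`. -/
structure ConvexLabelling (S : Finset Pt) (f : ℤ → Pt) (m p : ℤ) : Prop where
  inj : ∀ x y, m ≤ x → x ≤ p → m ≤ y → y ≤ p → f x = f y → x = y
  mem_iff : ∀ q, q ∈ S ↔ ∃ x, m ≤ x ∧ x ≤ p ∧ f x = q
  ccw : ∀ x y z, m ≤ x → x < y → y < z → z ≤ p → 0 < det2 (f x) (f y) (f z)

namespace ConvexLabelling

variable {S : Finset Pt} {f : ℤ → Pt} {m p : ℤ}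

lemma segCross_iff_of_lt (hf : ConvexLabelling S f m p) {i j k l : ℤ} (hi : m ≤ i) (hij : i < j)
    (hj : j ≤ p) (hk : m ≤ k) (hkl : k < l) (hl : l ≤ p) (hne : i ≠ k ∨ j ≠ l) :
    SegCross (f i, f j) (f k, f l) ↔ Interleave (i, j) (k, l) := by
  have hin : ∀ x, i < x → x < j → det2 (f i) (f j) (f x) < 0 := fun x h1 h2 => by
    rw [det2_swap]
    have := hf.ccw i x j hi h1 h2 hj
    linarith
  have hright : ∀ x, j < x → x ≤ p → 0 < det2 (f i) (f j) (f x) := fun x h1 h2 =>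
    hf.ccw i j x hi hij h1 h2
  have hleft : ∀ x, x < i → m ≤ x → 0 < det2 (f i) (f j) (f x) := fun x h1 h2 => by
    rw [det2_rotate]
    exact hf.ccw x i j h2 h1 hij hj
  have hi0 : det2 (f i) (f j) (f i) = 0 := by
    unfold det2
    ring
  have hj0 : det2 (f i) (f j) (f j) = 0 := by
    unfold det2
    ring
  constructor
  · intro h
    by_contra hcon
    by_cases hb : (i ≤ k ∧ k ≤ j) ∧ i ≤ l ∧ l ≤ j
    · have hle : ∀ x, i ≤ x → x ≤ j → det2 (f i) (f j) (f x) ≤ 0 := fun x h1 h2 => by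
        rcases h1.lt_or_eq with h1 | rfl
        · rcases h2.lt_or_eq with h2 | rfl
          · exact (hin x h1 h2).le
          · exact hj0.le
        · exact hi0.le
      refine not_segCross_of_nonpos (hle k hb.1.1 hb.1.2) (hle l hb.2.1 hb.2.2) ?_ h
      by_cases hik : i < k
      · have := hin k hik (by omega)
        linarith [hle l hb.2.1 hb.2.2]
      · have := hin l (by omega) (by omega)
        linarith [hle k hb.1.1 hb.1.2]
    · have hge : ∀ x, m ≤ x → x ≤ p → (x ≤ i ∨ j ≤ x) → 0 ≤ det2 (f i) (f j) (f x) :=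
        fun x h1 h2 h3 => by
        rcases h3 with h3 | h3
        · rcases h3.lt_or_eq with h3 | rfl
          · exact (hleft x h3 h1).le
          · exact hi0.ge
        · rcases h3.lt_or_eq with h3 | rfl
          · exact (hright x h3 h2).le
          · exact hj0.ge
      have hk' : k ≤ i ∨ j ≤ k := by
        unfold Interleave StrictBtw StrictOut at hcon
        omega
      have hl' : l ≤ i ∨ j ≤ l := by
        unfold Interleave StrictBtw StrictOut at hcon
        omega
      have h1 := hge k hk (by omega) hk'
      have h2 := hge l (by omega) hl hl'
      refine not_segCross_of_nonneg h1 h2 ?_ h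
      by_cases hk2 : k < i
      · linarith [hleft k hk2 hk]
      by_cases hl2 : j < l
      · linarith [hright l hl2 hl]
      omega
  · intro h
    have hcases : (i < k ∧ k < j ∧ j < l) ∨ (k < i ∧ i < l ∧ l < j) := by
      unfold Interleave StrictBtw StrictOut at h
      omega
    rcases hcases with ⟨h1, h2, h3⟩ | ⟨h1, h2, h3⟩
    · exact segCross_of_convex_quadrilateral (hf.ccw _ _ _ hi h1 h2 hj) (hf.ccw _ _ _ hi hij h3 hl)
        (hf.ccw _ _ _ hk h2 h3 hl) (hf.ccw _ _ _ hi h1 hkl hl)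
    · have := segCross_of_convex_quadrilateral (hf.ccw _ _ _ hk h1 h2 hl)
        (hf.ccw _ _ _ hk hkl h3 hj) (hf.ccw _ _ _ hi h2 h3 hj) (hf.ccw _ _ _ hk h1 hij hj)
      obtain ⟨x, hx1, hx2⟩ := this
      exact ⟨x, hx2, hx1⟩

lemma segCross_iff (hf : ConvexLabelling S f m p) {e g : ℤ × ℤ} (he₁ : m ≤ e.1 ∧ e.1 ≤ p)
    (he₂ : m ≤ e.2 ∧ e.2 ≤ p) (hg₁ : m ≤ g.1 ∧ g.1 ≤ p) (hg₂ : m ≤ g.2 ∧ g.2 ≤ p)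
    (he : e.1 ≠ e.2) (hg : g.1 ≠ g.2) (heg : e ≠ g) (heg' : e ≠ g.swap) :
    SegCross (Prod.map f f e) (Prod.map f f g) ↔ Interleave e g := by
  obtain ⟨i, j⟩ := e
  obtain ⟨k, l⟩ := g
  simp only [Prod.swap_prod_mk, ne_eq, Prod.mk.injEq] at *
  rcases lt_or_gt_of_ne he with hij | hij <;> rcases lt_or_gt_of_ne hg with hkl | hkl
  · exact hf.segCross_iff_of_lt he₁.1 hij he₂.2 hg₁.1 hkl hg₂.2 (by omega)
  · rw [← interleave_swap_right, ← segCross_swap_right]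
    exact hf.segCross_iff_of_lt he₁.1 hij he₂.2 hg₂.1 hkl hg₁.2 (by omega)
  · rw [← interleave_swap_left, ← segCross_swap_left]
    exact hf.segCross_iff_of_lt he₂.1 hij he₁.2 hg₁.1 hkl hg₂.2 (by omega)
  · rw [← interleave_swap_right, ← segCross_swap_right, ← interleave_swap_left,
      ← segCross_swap_left]
    exact hf.segCross_iff_of_lt he₂.1 hij he₁.2 hg₂.1 hkl hg₁.2 (by omega)

end ConvexLabelling

end Geometry

section Labelling

/-- The point `c` of a triangle with vertices `b`, `a`, `d` in barycentric form. -/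
lemma mem_convexHull_of_det2 {a b c d : Pt} {T : Set Pt} (ha : a ∈ T) (hb : b ∈ T) (hd : d ∈ T)
    (hac : 0 ≤ det2 b a c) (hcd : 0 ≤ det2 b c d) (hacd : det2 a c d ≤ 0)
    (had : 0 < det2 b a d) : c ∈ convexHull ℝ T := by
  have hconv := convex_convexHull ℝ T
  have hsum : det2 b c d + det2 b a c + - det2 a c d = det2 b a d := by
    unfold det2
    ring
  have := hconv.sum_mem (t := Finset.univ)
    (w := ![det2 b c d / det2 b a d, det2 b a c / det2 b a d, - det2 a c d / det2 b a d])
    (z := ![a, d, b]) ?_ ?_ ?_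
  · convert this using 1
    rw [Fin.sum_univ_three]
    ext <;> simp only [Matrix.cons_val, Prod.fst_add, Prod.snd_add, Prod.smul_fst, Prod.smul_snd,
      smul_eq_mul] <;> field_simp <;> unfold det2 <;> ring
  · intro i _
    fin_cases i
    · exact div_nonneg hcd had.le
    · exact div_nonneg hac had.le
    · exact div_nonneg (by linarith) had.le
  · rw [Fin.sum_univ_three]
    simp only [Matrix.cons_val]
    rw [← add_div, ← add_div, hsum, div_self had.ne']
  · intro i _
    fin_cases i
    · exact subset_convexHull ℝ T ha
    · exact subset_convexHull ℝ T hd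
    · exact subset_convexHull ℝ T hb

lemma exists_strict_support {S : Finset Pt} (hS : ConvexPosition S) {b : Pt} (hb : b ∈ S) :
    ∃ α β : ℝ, ∀ q ∈ S.erase b, 0 < α * (q.1 - b.1) + β * (q.2 - b.2) := by
  obtain ⟨φ, u, h1, h2⟩ := geometric_hahn_banach_point_closed
    (convex_convexHull ℝ ((S.erase b : Finset Pt) : Set Pt))
    (Set.Finite.isClosed_convexHull _ (S.erase b).finite_toSet) (hS b hb)
  refine ⟨φ (1, 0), φ (0, 1), fun q hq => ?_⟩
  have h3 := h1.trans (h2 q (subset_convexHull ℝ _ hq))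
  have hφ : ∀ v : Pt, φ v = v.1 * φ (1, 0) + v.2 * φ (0, 1) := fun v => by
    conv_lhs => rw [show v = v.1 • ((1, 0) : Pt) + v.2 • ((0, 1) : Pt) by ext <;> simp]
    rw [map_add, map_smul, map_smul, smul_eq_mul, smul_eq_mul]
  rw [hφ b, hφ q] at h3
  linarith

/-- Seen from a point of a convex polygon, the other vertices are sorted by a real key. -/
lemma exists_radial_key {S : Finset Pt} (hS : ConvexPosition S) {b : Pt} (hb : b ∈ S) :
    ∃ κ : Pt → ℝ, (∀ q ∈ S.erase b, ∀ q' ∈ S.erase b, κ q < κ q' ↔ 0 < det2 b q q') ∧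
      ∀ q ∈ S.erase b, ∀ q' ∈ S.erase b, κ q = κ q' → q = q' := by
  obtain ⟨α, β, hαβ⟩ := exists_strict_support hS hb
  set D : Pt → ℝ := fun q => α * (q.1 - b.1) + β * (q.2 - b.2) with hD
  set ψ : Pt → ℝ := fun q => α * (q.2 - b.2) - β * (q.1 - b.1) with hψ
  have hcross : ∀ q q', D q * ψ q' - ψ q * D q' = (α ^ 2 + β ^ 2) * det2 b q q' := fun q q' => by
    simp only [hD, hψ]
    unfold det2
    ring
  have hpos : ∀ q ∈ S.erase b, 0 < α ^ 2 + β ^ 2 := fun q hq => by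
    by_contra hcon
    have hα : α = 0 := by nlinarith [sq_nonneg α, sq_nonneg β]
    have hβ : β = 0 := by nlinarith [sq_nonneg α, sq_nonneg β]
    have := hαβ q hq
    simp [hα, hβ] at this
  refine ⟨fun q => ψ q / D q, fun q hq q' hq' => ?_, fun q hq q' hq' h => ?_⟩
  · rw [div_lt_div_iff₀ (hαβ q hq) (hαβ q' hq'), ← mul_pos_iff_of_pos_left (hpos q hq), ← hcross]
    simp only [hD]
    constructor <;> intro h <;> nlinarith
  · rw [div_eq_div_iff (hαβ q hq).ne' (hαβ q' hq').ne'] at h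
    have hdet : det2 b q q' = 0 := by
      have := hcross q q'
      have hp := hpos q hq
      have h0 : (α ^ 2 + β ^ 2) * det2 b q q' = 0 := by rw [← this]; linarith
      exact (mul_eq_zero.1 h0).resolve_left hp.ne'
    have hne : ∀ q ∈ S.erase b, ∀ q' ∈ S.erase b, det2 b q q' = 0 → D q < D q' → False := by
      intro q hq q' hq' hdet hlt
      have hDq : 0 < D q := hαβ q hq
      have hDq' : 0 < D q' := hαβ q' hq'
      have hqq' : q ≠ q' := by
        rintro rfl
        exact lt_irrefl _ hlt
      have hqb := Finset.ne_of_mem_erase hq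
      refine hS q (Finset.mem_of_mem_erase hq) ?_
      refine (convex_convexHull ℝ _).segment_subset
        (subset_convexHull ℝ _ (Finset.mem_coe.2 (Finset.mem_erase.2 ⟨hqb.symm, hb⟩)))
        (subset_convexHull ℝ _ (Finset.mem_coe.2 (Finset.mem_erase.2
          ⟨hqq'.symm, Finset.mem_of_mem_erase hq'⟩))) ?_
      refine ⟨1 - D q / D q', D q / D q', ?_, by positivity, by ring, ?_⟩
      · rw [sub_nonneg, div_le_one hDq']
        exact hlt.le
      · unfold det2 at hdet
        ext <;> simp only [Prod.fst_add, Prod.snd_add, Prod.smul_fst, Prod.smul_snd, smul_eq_mul]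
          <;> field_simp <;> simp only [hD]
        · linear_combination -β * hdet
        · linear_combination α * hdet
    rcases lt_trichotomy (D q) (D q') with hlt | heq | hlt
    · exact (hne q hq q' hq' hdet hlt).elim
    · replace h : ψ q * D q' = ψ q' * D q := h
      rw [heq] at h
      have hψq : ψ q = ψ q' := mul_right_cancel₀ (hαβ q' hq').ne' h
      have hp := hpos q hq
      simp only [hD, hψ] at heq hψq
      have e1 : (α ^ 2 + β ^ 2) * (q.1 - q'.1) = 0 := by
        linear_combination α * heq - β * hψq
      have e2 : (α ^ 2 + β ^ 2) * (q.2 - q'.2) = 0 := by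
        linear_combination β * heq + α * hψq
      ext
      · exact sub_eq_zero.1 ((mul_eq_zero.1 e1).resolve_left hp.ne')
      · exact sub_eq_zero.1 ((mul_eq_zero.1 e2).resolve_left hp.ne')
    · refine (hne q' hq' q hq ?_ hlt).elim
      rw [det2_swap, hdet, neg_zero]

lemma exists_convexLabelling {S : Finset Pt} (hS : ConvexPosition S) {r b : Pt} (hr : r ∈ S)
    (hb : b ∈ S) (hrb : r ≠ b) :
    ∃ f m p, m ≤ 0 ∧ 0 < p ∧ f 0 = r ∧ f p = b ∧ ConvexLabelling S f m p := by
  obtain ⟨κ, hκ, hinj⟩ := exists_radial_key hS hb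
  obtain ⟨k, hk⟩ : ∃ k, ((S.erase b).image κ).card = k := ⟨_, rfl⟩
  set o := ((S.erase b).image κ).orderEmbOfFin hk
  have ho : ∀ i, ∃ q ∈ S.erase b, κ q = o i := fun i =>
    Finset.mem_image.1 (Finset.orderEmbOfFin_mem _ hk i)
  choose g hgS hgκ using ho
  have hgsurj : ∀ q ∈ S.erase b, ∃ i, g i = q := fun q hq => by
    have : κ q ∈ Set.range o := by
      rw [Finset.range_orderEmbOfFin]
      exact Finset.mem_coe.2 (Finset.mem_image_of_mem _ hq)
    obtain ⟨i, hi⟩ := this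
    exact ⟨i, hinj _ (hgS i) _ hq (by rw [hgκ, hi])⟩
  have hgb : ∀ i j, i < j → 0 < det2 b (g i) (g j) := fun i j hij => by
    rw [← hκ _ (hgS i) _ (hgS j), hgκ, hgκ]
    exact o.strictMono hij
  have hginj : ∀ i j, g i = g j → i = j := fun i j h => by
    apply o.injective
    rw [← hgκ, ← hgκ, h]
  have hg3 : ∀ i j l, i < j → j < l → 0 < det2 (g i) (g j) (g l) := fun i j l hij hjl => by
    by_contra hcon
    refine hS (g j) (Finset.mem_of_mem_erase (hgS j)) (mem_convexHull_of_det2 (a := g i) (b := b)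
      (d := g l) ?_ ?_ ?_ (hgb i j hij).le (hgb j l hjl).le (not_lt.1 hcon)
      (hgb i l (hij.trans hjl)))
    · exact Finset.mem_coe.2 (Finset.mem_erase.2
        ⟨fun h => hij.ne (hginj _ _ h), Finset.mem_of_mem_erase (hgS i)⟩)
    · exact Finset.mem_coe.2 (Finset.mem_erase.2
        ⟨(Finset.ne_of_mem_erase (hgS j)).symm, hb⟩)
    · exact Finset.mem_coe.2 (Finset.mem_erase.2
        ⟨fun h => hjl.ne' (hginj _ _ h), Finset.mem_of_mem_erase (hgS l)⟩)
  obtain ⟨i₀, hi₀⟩ := hgsurj r (Finset.mem_erase.2 ⟨hrb, hr⟩)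
  set f : ℤ → Pt := fun x => if hx : 0 ≤ x + i₀ ∧ (x + i₀).toNat < k then g ⟨(x + i₀).toNat, hx.2⟩
    else b with hf
  have hfg : ∀ x : ℤ, ∀ i : Fin k, x + i₀ = i → f x = g i := fun x i hxi => by
    have h : 0 ≤ x + i₀ ∧ (x + i₀).toNat < k := by
      have := i.2
      omega
    rw [hf]
    dsimp only
    rw [dif_pos h]
    congr 1
    ext
    simp only
    omega
  have hgf : ∀ x : ℤ, - (i₀ : ℤ) ≤ x → x < k - i₀ → ∃ i : Fin k, x + i₀ = i ∧ f x = g i :=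
    fun x h1 h2 => ⟨⟨(x + i₀).toNat, by omega⟩, by simp only; omega, hfg _ _ (by simp only; omega)⟩
  have hfb : f (k - i₀) = b := dif_neg (by omega)
  refine ⟨f, - (i₀ : ℤ), k - i₀, by omega, by omega, ?_, hfb, ?_, ?_, ?_⟩
  · rw [← hi₀]
    exact hfg _ _ (by simp)
  · intro x y hx hx' hy hy' hxy
    rcases hx'.lt_or_eq with hx' | rfl <;> rcases hy'.lt_or_eq with hy' | rfl
    · obtain ⟨i, hi, hi'⟩ := hgf x hx hx'
      obtain ⟨j, hj, hj'⟩ := hgf y hy hy'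
      rw [hi', hj'] at hxy
      have := hginj _ _ hxy
      subst this
      omega
    · obtain ⟨i, hi, hi'⟩ := hgf x hx hx'
      rw [hi', hfb] at hxy
      exact absurd hxy (Finset.ne_of_mem_erase (hgS i))
    · obtain ⟨i, hi, hi'⟩ := hgf y hy hy'
      rw [hi', hfb] at hxy
      exact absurd hxy.symm (Finset.ne_of_mem_erase (hgS i))
    · rfl
  · intro q
    constructor
    · intro hq
      by_cases hqb : q = b
      · exact ⟨k - i₀, by omega, le_rfl, by rw [hfb, hqb]⟩
      · obtain ⟨i, rfl⟩ := hgsurj q (Finset.mem_erase.2 ⟨hqb, hq⟩)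
        exact ⟨i - i₀, by omega, by omega, hfg _ _ (by omega)⟩
    · rintro ⟨x, hx, hx', rfl⟩
      rcases hx'.lt_or_eq with hx' | rfl
      · obtain ⟨i, hi, hi'⟩ := hgf x hx hx'
        rw [hi']
        exact Finset.mem_of_mem_erase (hgS i)
      · rwa [hfb]
  · intro x y z hx hxy hyz hz
    obtain ⟨i, hi, hi'⟩ := hgf x hx (by omega)
    obtain ⟨j, hj, hj'⟩ := hgf y (by omega) (by omega)
    rw [hi', hj']
    rcases hz.lt_or_eq with hz | rfl
    · obtain ⟨l, hl, hl'⟩ := hgf z (by omega) hz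
      rw [hl']
      exact hg3 _ _ _ (by rw [Fin.lt_def]; omega) (by rw [Fin.lt_def]; omega)
    · rw [hfb, det2_rotate]
      exact hgb _ _ (by rw [Fin.lt_def]; omega)

end Labelling

section Transfer

lemma onePlane_iff {es : List (Pt × Pt)} (hnd : es.Nodup) :
    OnePlane es ↔ ∀ e ∈ es, ∀ f ∈ es, ∀ g ∈ es, f ≠ e → g ≠ e → SegCross e f → SegCross e g →
      f = g := by
  unfold OnePlane edgeCrossCount
  simp only [Finset.card_le_one, Finset.mem_filter, Finset.mem_range]
  constructor
  · intro h e he f hf g hg hfe hge hef heg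
    obtain ⟨i, hi, rfl⟩ := List.getElem_of_mem he
    obtain ⟨j, hj, rfl⟩ := List.getElem_of_mem hf
    obtain ⟨k, hk, rfl⟩ := List.getElem_of_mem hg
    have := h i hi j ⟨hj, fun hji => hfe (by simp [hji]), ?_⟩ k
      ⟨hk, fun hki => hge (by simp [hki]), ?_⟩
    · simp [this]
    · rwa [List.getD_eq_getElem _ _ hi, List.getD_eq_getElem _ _ hj]
    · rwa [List.getD_eq_getElem _ _ hi, List.getD_eq_getElem _ _ hk]
  · rintro h i hi j ⟨hj, hji, hij⟩ k ⟨hk, hki, hik⟩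
    rw [List.getD_eq_getElem _ _ hi] at hij hik
    rw [List.getD_eq_getElem _ _ hj] at hij
    rw [List.getD_eq_getElem _ _ hk] at hik
    have := h _ (List.getElem_mem hi) _ (List.getElem_mem hj) _ (List.getElem_mem hk)
      (fun h => hji (hnd.getElem_inj_iff.1 h)) (fun h => hki (hnd.getElem_inj_iff.1 h)) hij hik
    exact hnd.getElem_inj_iff.1 this

variable {S : Finset Pt} {f : ℤ → Pt} {m p : ℤ}

lemma ConvexLabelling.onePlane_map_iff (hf : ConvexLabelling S f m p) {l : List ℤ}
    (hl : l.Nodup) (hmp : ∀ x ∈ l, m ≤ x ∧ x ≤ p) :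
    OnePlane (pathEdges (l.map f)) ↔ IdxOnePlane l := by
  have hinj : ∀ x ∈ l, ∀ y ∈ l, f x = f y → x = y := fun x hx y hy =>
    hf.inj x y (hmp x hx).1 (hmp x hx).2 (hmp y hy).1 (hmp y hy).2
  have hE : pathEdges (l.map f) = (consec l).map (Prod.map f f) := consec_map f l
  have hcross : ∀ e ∈ consec l, ∀ g ∈ consec l, e ≠ g →
      (SegCross (Prod.map f f e) (Prod.map f f g) ↔ Interleave e g) := fun e he g hg heg => by
    have he' := mem_of_mem_consec he
    have hg' := mem_of_mem_consec hg
    refine hf.segCross_iff (hmp _ he'.1) (hmp _ he'.2) (hmp _ hg'.1) (hmp _ hg'.2)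
      (fst_ne_snd_of_mem_consec hl e he) (fst_ne_snd_of_mem_consec hl g hg) heg ?_
    rintro rfl
    exact swap_notMem_consec hl g hg he
  have hinj' : ∀ e ∈ consec l, ∀ g ∈ consec l, Prod.map f f e = Prod.map f f g → e = g :=
    fun e he g hg h => by
    have he' := mem_of_mem_consec he
    have hg' := mem_of_mem_consec hg
    rw [Prod.ext_iff] at h
    exact Prod.ext (hinj _ he'.1 _ hg'.1 h.1) (hinj _ he'.2 _ hg'.2 h.2)
  have hself : ∀ e : ℤ × ℤ, ¬ Interleave e e := fun e => by
    unfold Interleave StrictBtw StrictOut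
    omega
  rw [hE, onePlane_iff (List.Nodup.map_on hinj' (nodup_consec hl))]
  simp only [List.forall_mem_map]
  constructor
  · intro h e he g hg k hk h1 h2
    have hge : g ≠ e := fun h => hself e (h ▸ h1)
    have hke : k ≠ e := fun h => hself e (h ▸ h2)
    exact hinj' g hg k hk (h e he g hg k hk (fun h => hge (hinj' _ hg _ he h))
      (fun h => hke (hinj' _ hk _ he h)) ((hcross e he g hg hge.symm).2 h1)
      ((hcross e he k hk hke.symm).2 h2))
  · intro h e he g hg k hk hge hke h1 h2
    have hge' : e ≠ g := fun h => hge (by rw [h])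
    have hke' : e ≠ k := fun h => hke (by rw [h])
    rw [h e he g hg k hk ((hcross e he g hg hge').1 h1) ((hcross e he k hk hke').1 h2)]

/-- The colouring of labels induced by the red points: `1` for red and `-1` for blue. -/
def colour (R : Finset Pt) (f : ℤ → Pt) (x : ℤ) : ℤ := if f x ∈ R then 1 else -1

lemma ConvexLabelling.exists_hamAltPath_iff {R B : Finset Pt} (hdisj : Disjoint R B)
    (hf : ConvexLabelling (R ∪ B) f m p) (hm : m ≤ 0) (hp : 0 < p) :
    (∃ P : HamAltPath R B (f 0) (f p), OnePlane (pathEdges P.verts)) ↔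
      HasPath (colour R f) 0 p (fun x => m ≤ x ∧ x ≤ p) := by
  have hcol : ∀ x y, m ≤ x → x ≤ p → m ≤ y → y ≤ p →
      (Bichromatic R B (f x, f y) ↔ colour R f x ≠ colour R f y) := fun x y hx hx' hy hy' => by
    have h1 := (hf.mem_iff (f x)).2 ⟨x, hx, hx', rfl⟩
    have h2 := (hf.mem_iff (f y)).2 ⟨y, hy, hy', rfl⟩
    have h3 : f x ∈ R → f x ∉ B := fun h => Finset.disjoint_left.1 hdisj h
    have h4 : f y ∈ R → f y ∉ B := fun h => Finset.disjoint_left.1 hdisj h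
    rw [Finset.mem_union] at h1 h2
    unfold Bichromatic colour
    by_cases hxR : f x ∈ R <;> by_cases hyR : f y ∈ R <;> simp [hxR, hyR] <;> tauto
  constructor
  · rintro ⟨P, hP⟩
    have hsur : ∀ q, q ∈ P.verts ↔ ∃ x, m ≤ x ∧ x ≤ p ∧ f x = q := fun q => by
      rw [← hf.mem_iff, ← P.cover, List.mem_toFinset]
    set g : Pt → ℤ := fun q => if h : ∃ x, m ≤ x ∧ x ≤ p ∧ f x = q then h.choose else 0 with hg
    have hgs : ∀ q ∈ P.verts, m ≤ g q ∧ g q ≤ p ∧ f (g q) = q := fun q hq => by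
      have := (hsur q).1 hq
      simp only [hg, dif_pos this]
      exact this.choose_spec
    have hgf : ∀ x, m ≤ x → x ≤ p → g (f x) = x := fun x hx hx' => by
      have := hgs (f x) ((hsur _).2 ⟨x, hx, hx', rfl⟩)
      exact hf.inj _ _ this.1 this.2.1 hx hx' this.2.2
    have hmap : (P.verts.map g).map f = P.verts := by
      rw [List.map_map]
      conv_rhs => rw [← List.map_id P.verts]
      exact List.map_congr_left fun q hq => (hgs q hq).2.2
    have hmem : ∀ x, x ∈ P.verts.map g ↔ m ≤ x ∧ x ≤ p := fun x => by
      rw [List.mem_map]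
      constructor
      · rintro ⟨q, hq, rfl⟩
        exact ⟨(hgs q hq).1, (hgs q hq).2.1⟩
      · rintro ⟨h1, h2⟩
        exact ⟨f x, (hsur _).2 ⟨x, h1, h2, rfl⟩, hgf x h1 h2⟩
    have hnd : (P.verts.map g).Nodup := List.Nodup.of_map f (by rw [hmap]; exact P.nodup)
    refine ⟨P.verts.map g, ?_, ?_, hnd, hmem, ?_, ?_⟩
    · rw [List.head?_map, P.head_eq, Option.map_some, hgf 0 hm hp.le]
    · rw [List.getLast?_map, P.last_eq, Option.map_some, hgf p (by omega) le_rfl]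
    · intro e he
      have he' := mem_of_mem_consec he
      have h1 := (hmem _).1 he'.1
      have h2 := (hmem _).1 he'.2
      rw [← hcol _ _ h1.1 h1.2 h2.1 h2.2]
      refine P.alt (f e.1, f e.2) ?_
      have : pathEdges P.verts = (consec (P.verts.map g)).map (Prod.map f f) := by
        rw [← consec_map, hmap]
        rfl
      rw [this]
      exact List.mem_map_of_mem he
    · rwa [← hf.onePlane_map_iff hnd fun x hx => (hmem x).1 hx, hmap]
  · rintro ⟨l, h1, h2, h3, h4, h5, h6⟩
    refine ⟨⟨l.map f, ?_, ?_, ?_, ?_, ?_⟩, ?_⟩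
    · refine List.Nodup.map_on (fun x hx y hy => ?_) h3
      exact hf.inj x y ((h4 x).1 hx).1 ((h4 x).1 hx).2 ((h4 y).1 hy).1 ((h4 y).1 hy).2
    · ext q
      rw [List.mem_toFinset, hf.mem_iff, List.mem_map]
      simp only [h4, and_assoc]
    · rw [List.head?_map, h1, Option.map_some]
    · rw [List.getLast?_map, h2, Option.map_some]
    · intro e he
      have : pathEdges (l.map f) = (consec l).map (Prod.map f f) := consec_map f l
      rw [this, List.mem_map] at he
      obtain ⟨e, he, rfl⟩ := he
      have he' := mem_of_mem_consec he
      have g1 := (h4 _).1 he'.1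
      have g2 := (h4 _).1 he'.2
      exact (hcol _ _ g1.1 g1.2 g2.1 g2.2).2 (h5 e he)
    · exact (hf.onePlane_map_iff h3 fun x hx => (h4 x).1 hx).2 h6

end Transfer

section Radial

/-- `q` enumerates `T` increasingly for the relation `rel`. -/
def OrderedBy (rel : Pt → Pt → Prop) {k : ℕ} (q : Fin k → Pt) (T : Finset Pt) : Prop :=
  Function.Injective q ∧ Finset.univ.image q = T ∧ ∀ i j : Fin k, i < j → rel (q i) (q j)

lemma OrderedBy.card {rel : Pt → Pt → Prop} {k : ℕ} {q : Fin k → Pt} {T : Finset Pt}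
    (hq : OrderedBy rel q T) : T.card = k := by
  rw [← hq.2.1, Finset.card_image_of_injective _ hq.1, Finset.card_univ, Fintype.card_fin]

lemma OrderedBy.unique {rel : Pt → Pt → Prop} (hrel : ∀ a b, rel a b → ¬ rel b a) {k : ℕ}
    {q q' : Fin k → Pt} {T : Finset Pt} (hq : OrderedBy rel q T) (hq' : OrderedBy rel q' T) :
    q = q' := by
  have hex : ∀ i, ∃ j, q' j = q i := fun i => by
    have : q i ∈ Finset.univ.image q' := by
      rw [hq'.2.1, ← hq.2.1]
      exact Finset.mem_image_of_mem _ (Finset.mem_univ _)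
    obtain ⟨j, -, hj⟩ := Finset.mem_image.1 this
    exact ⟨j, hj⟩
  choose e he using hex
  have hmono : StrictMono e := fun i j hij => by
    rcases lt_trichotomy (e i) (e j) with h | h | h
    · exact h
    · have := he i
      rw [h, he] at this
      exact absurd (hq.1 this) hij.ne'
    · have h1 := hq'.2.2 _ _ h
      rw [he, he] at h1
      exact absurd h1 (hrel _ _ (hq.2.2 i j hij))
  have hid : e = id := hmono.eq_id
  ext1 i
  rw [← he i, hid, id]

lemma balancedAt_iff {A C : Finset Pt} {k : ℕ} {q : Fin k → Pt} {H : ℕ → ℤ}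
    (hH : ∀ i : Fin k, (q i ∈ A ∧ q i ∉ C ∧ H (i + 1) = H i + 1) ∨
      (q i ∈ C ∧ q i ∉ A ∧ H (i + 1) = H i - 1)) (j : Fin k) :
    BalancedAt A C q j ↔ H (j + 1) = H 0 - 1 := by
  have hsum : ∑ i : Fin k, (if i ≤ j then H (i + 1) - H i else 0) = H (j + 1) - H 0 := by
    have h1 := Fin.sum_univ_eq_sum_range (fun i => if i ≤ (j : ℕ) then H (i + 1) - H i else 0) k
    simp only [← Fin.le_def] at h1 ⊢
    rw [h1, ← Finset.sum_filter, ← Finset.sum_range_sub]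
    refine Finset.sum_congr ?_ fun _ _ => rfl
    ext i
    rw [Finset.mem_filter, Finset.mem_range, Finset.mem_range]
    omega
  have hcard : ((Finset.univ.filter fun i : Fin k => i ≤ j ∧ q i ∈ A).card : ℤ)
      - (Finset.univ.filter fun i : Fin k => i ≤ j ∧ q i ∈ C).card = H (j + 1) - H 0 := by
    rw [← hsum, Finset.card_filter, Finset.card_filter]
    push_cast
    rw [← Finset.sum_sub_distrib]
    refine Finset.sum_congr rfl fun i _ => ?_
    by_cases hij : i ≤ j
    · rcases hH i with ⟨h1, h2, h3⟩ | ⟨h1, h2, h3⟩ <;> simp [hij, h1, h2, h3]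
    · simp [hij]
  unfold BalancedAt
  omega

/-- The first balanced point of the radial order is read off the partial sums `H`. -/
lemma forall_firstBalanced_iff {rel : Pt → Pt → Prop} (hrel : ∀ a b, rel a b → ¬ rel b a)
    {A C T : Finset Pt} {K : ℕ} {q : Fin K → Pt} (hq : OrderedBy rel q T) {H : ℕ → ℤ}
    (hH : ∀ i : Fin K, (q i ∈ A ∧ q i ∉ C ∧ H (i + 1) = H i + 1) ∨
      (q i ∈ C ∧ q i ∉ A ∧ H (i + 1) = H i - 1)) (hK : H K = H 0 - 1) (j₀ : Fin K) :
    (∀ (k : ℕ) (q' : Fin k → Pt), OrderedBy rel q' T → ∀ j, FirstBalanced A C q' j →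
      q' j = q j₀) ↔ (∀ t : ℕ, t ≤ j₀ → H t ≠ H 0 - 1) ∧ H (j₀ + 1) = H 0 - 1 := by
  have hbal := balancedAt_iff hH
  constructor
  · intro h
    have hex : ∃ t, t < K ∧ H (t + 1) = H 0 - 1 :=
      ⟨K - 1, by have := j₀.2; omega, by rw [← hK]; congr 1; have := j₀.2; omega⟩
    have hfirst : FirstBalanced A C q ⟨Nat.find hex, (Nat.find_spec hex).1⟩ := by
      refine ⟨(hbal _).2 (Nat.find_spec hex).2, fun j' hj' hj'' => ?_⟩
      exact Nat.find_min hex hj' ⟨j'.2, (hbal _).1 hj''⟩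
    have hj := hq.1 (h K q hq _ hfirst)
    rw [hj] at hfirst
    refine ⟨fun t ht hHt => ?_, (hbal _).1 hfirst.1⟩
    rcases t with _ | t
    · omega
    · exact hfirst.2 ⟨t, by omega⟩ (by rw [Fin.lt_def]; simp only; omega) ((hbal _).2 hHt)
  · rintro ⟨h1, h2⟩ k q' hq' j hj
    obtain rfl : k = K := by rw [← hq.card, ← hq'.card]
    obtain rfl := hq.unique hrel hq'
    congr 1
    rcases lt_trichotomy j j₀ with hlt | heq | hlt
    · exact absurd ((hbal _).1 hj.1) (h1 (j + 1) hlt)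
    · exact heq
    · exact absurd ((hbal _).2 h2) (hj.2 _ hlt)

/-- The labels `v`, `x`, `y` occur in this cyclic order. -/
def Cyc (v x y : ℤ) : Prop := (v < x ∧ x < y) ∨ (x < y ∧ y < v) ∨ (y < v ∧ v < x)

namespace ConvexLabelling

variable {S : Finset Pt} {f : ℤ → Pt} {m p : ℤ}

lemma mem (hf : ConvexLabelling S f m p) {x : ℤ} (hx : m ≤ x) (hx' : x ≤ p) : f x ∈ S :=
  (hf.mem_iff _).2 ⟨x, hx, hx', rfl⟩

lemma det2_pos (hf : ConvexLabelling S f m p) {v x y : ℤ} (hv : m ≤ v ∧ v ≤ p)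
    (hx : m ≤ x ∧ x ≤ p) (hy : m ≤ y ∧ y ≤ p) (h : Cyc v x y) : 0 < det2 (f v) (f x) (f y) := by
  rcases h with ⟨h1, h2⟩ | ⟨h1, h2⟩ | ⟨h1, h2⟩
  · exact hf.ccw _ _ _ hv.1 h1 h2 hy.2
  · rw [← det2_rotate]
    exact hf.ccw _ _ _ hx.1 h1 h2 hv.2
  · rw [← det2_rotate, ← det2_rotate]
    exact hf.ccw _ _ _ hy.1 h1 h2 hx.2

lemma image_erase (hf : ConvexLabelling S f m p) {v : ℤ} (hv : m ≤ v ∧ v ≤ p) {K : ℕ} {u : ℕ → ℤ}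
    (hu : ∀ t < K, m ≤ u t ∧ u t ≤ p ∧ u t ≠ v)
    (hsurj : ∀ x, m ≤ x → x ≤ p → x ≠ v → ∃ t < K, u t = x) :
    Finset.univ.image (fun i : Fin K => f (u i)) = S.erase (f v) := by
  ext q
  rw [Finset.mem_image, Finset.mem_erase, hf.mem_iff]
  constructor
  · rintro ⟨i, -, rfl⟩
    obtain ⟨h1, h2, h3⟩ := hu i i.2
    exact ⟨fun h => h3 (hf.inj _ _ h1 h2 hv.1 hv.2 h), u i, h1, h2, rfl⟩
  · rintro ⟨hne, x, h1, h2, rfl⟩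
    obtain ⟨t, ht, rfl⟩ := hsurj x h1 h2 fun h => hne (by rw [h])
    exact ⟨⟨t, ht⟩, Finset.mem_univ _, rfl⟩

lemma ccwOrder (hf : ConvexLabelling S f m p) {v : ℤ} (hv : m ≤ v ∧ v ≤ p) {K : ℕ} {u : ℕ → ℤ}
    (hu : ∀ t < K, m ≤ u t ∧ u t ≤ p ∧ u t ≠ v)
    (hsurj : ∀ x, m ≤ x → x ≤ p → x ≠ v → ∃ t < K, u t = x)
    (hcyc : ∀ s t, s < t → t < K → Cyc v (u s) (u t)) :
    OrderedBy (fun a b => 0 < det2 (f v) a b) (fun i : Fin K => f (u i)) (S.erase (f v)) := by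
  have hu' := fun i : Fin K => hu i i.2
  have key : ∀ i j : Fin K, i < j → 0 < det2 (f v) (f (u i)) (f (u j)) := fun i j hij =>
    hf.det2_pos hv ⟨(hu' i).1, (hu' i).2.1⟩ ⟨(hu' j).1, (hu' j).2.1⟩ (hcyc _ _ hij j.2)
  have hself : ∀ a b : Pt, det2 a b b = 0 := fun a b => by
    unfold det2
    ring
  refine ⟨fun i j hij => ?_, hf.image_erase hv hu hsurj, key⟩
  dsimp only at hij
  rcases lt_trichotomy i j with h | h | h
  · have := key i j h
    rw [hij, hself] at this
    exact absurd this (lt_irrefl _)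
  · exact h
  · have := key j i h
    rw [hij, hself] at this
    exact absurd this (lt_irrefl _)

lemma cwOrder (hf : ConvexLabelling S f m p) {v : ℤ} (hv : m ≤ v ∧ v ≤ p) {K : ℕ} {u : ℕ → ℤ}
    (hu : ∀ t < K, m ≤ u t ∧ u t ≤ p ∧ u t ≠ v)
    (hsurj : ∀ x, m ≤ x → x ≤ p → x ≠ v → ∃ t < K, u t = x)
    (hcyc : ∀ s t, s < t → t < K → Cyc v (u t) (u s)) :
    OrderedBy (fun a b => det2 (f v) a b < 0) (fun i : Fin K => f (u i)) (S.erase (f v)) := by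
  have hu' := fun i : Fin K => hu i i.2
  have key : ∀ i j : Fin K, i < j → det2 (f v) (f (u i)) (f (u j)) < 0 := fun i j hij => by
    have := hf.det2_pos hv ⟨(hu' j).1, (hu' j).2.1⟩ ⟨(hu' i).1, (hu' i).2.1⟩ (hcyc _ _ hij j.2)
    rw [det2_swap] at this
    linarith
  have hself : ∀ a b : Pt, det2 a b b = 0 := fun a b => by
    unfold det2
    ring
  refine ⟨fun i j hij => ?_, hf.image_erase hv hu hsurj, key⟩
  dsimp only at hij
  rcases lt_trichotomy i j with h | h | h
  · have := key i j h
    rw [hij, hself] at this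
    exact absurd this (lt_irrefl _)
  · exact h
  · have := key j i h
    rw [hij, hself] at this
    exact absurd this (lt_irrefl _)

end ConvexLabelling

lemma CWList.det2_cycSucc_neg {M : ℕ} {pt : Fin M → Pt} (hpt : CWList pt) (hM : 0 < M)
    {i j : Fin M} (hji : j ≠ i) (hjs : j ≠ cycSucc hM i) :
    det2 (pt i) (pt (cycSucc hM i)) (pt j) < 0 := by
  have hi := i.2
  have hj := j.2
  rw [Ne, Fin.ext_iff] at hji hjs
  by_cases hlast : i.val + 1 = M
  · have hs : (cycSucc hM i).val = 0 := by simp [cycSucc, hlast]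
    rw [← det2_rotate]
    rw [hs] at hjs
    refine hpt.2 _ _ _ ?_ ?_ <;> rw [Fin.lt_def] <;> omega
  · have hs : (cycSucc hM i).val = i.val + 1 := Nat.mod_eq_of_lt (by omega)
    rw [hs] at hjs
    rcases lt_or_gt_of_ne hji with h | h
    · rw [← det2_rotate, ← det2_rotate]
      refine hpt.2 _ _ _ ?_ ?_ <;> rw [Fin.lt_def] <;> omega
    · refine hpt.2 _ _ _ ?_ ?_ <;> rw [Fin.lt_def] <;> omega

lemma cycSucc_cycPred {M : ℕ} (hM : 0 < M) (i : Fin M) : cycSucc hM (cycPred hM i) = i := by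
  have hi := i.2
  ext
  simp only [cycSucc, cycPred, Nat.mod_add_mod]
  rw [show i.val + (M - 1) + 1 = i.val + M by omega, Nat.add_mod_right, Nat.mod_eq_of_lt hi]

lemma cycSucc_ne {M : ℕ} (hM : 0 < M) (hM' : 1 < M) (i : Fin M) : cycSucc hM i ≠ i := by
  have hi := i.2
  intro h
  rw [Fin.ext_iff] at h
  simp only [cycSucc] at h
  by_cases hlast : i.val + 1 = M
  · simp [hlast] at h
    omega
  · rw [Nat.mod_eq_of_lt (by omega)] at h
    omega

lemma hullPts_eq_self {S : Finset Pt} (hS : ConvexPosition S) : hullPts S = S :=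
  Finset.filter_true_of_mem hS

namespace ConvexLabelling

variable {S : Finset Pt} {f : ℤ → Pt} {m p : ℤ}

lemma apply_cycSucc (hf : ConvexLabelling S f m p) {M : ℕ} {pt : Fin M → Pt} (hpt : CWList pt)
    (himg : Finset.univ.image pt = S) (hM : 0 < M) {i : Fin M} {v w : ℤ} (hv : m ≤ v ∧ v ≤ p)
    (hw : m ≤ w ∧ w ≤ p) (hvw : v ≠ w) (hiv : pt i = f v)
    (hcyc : ∀ x, m ≤ x → x ≤ p → x ≠ v → x ≠ w → Cyc v x w) : pt (cycSucc hM i) = f w := by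
  have hmem : ∀ j, pt j ∈ S := fun j => himg ▸ Finset.mem_image_of_mem _ (Finset.mem_univ j)
  obtain ⟨j, -, hj⟩ := Finset.mem_image.1 (himg.symm ▸ hf.mem hw.1 hw.2 : f w ∈ _)
  have hji : j ≠ i := by
    rintro rfl
    exact hvw (hf.inj _ _ hv.1 hv.2 hw.1 hw.2 (by rw [← hiv, hj]))
  have hM' : 1 < M := by
    rw [Ne, Fin.ext_iff] at hji
    omega
  obtain ⟨x, hx, hx', hxs⟩ := (hf.mem_iff _).1 (hmem (cycSucc hM i))
  by_contra hcon
  have hxw : x ≠ w := by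
    rintro rfl
    exact hcon hxs.symm
  have hxv : x ≠ v := by
    rintro rfl
    exact cycSucc_ne hM hM' i (hpt.1 (by rw [← hxs, hiv]))
  have h1 := hf.det2_pos hv ⟨hx, hx'⟩ hw (hcyc x hx hx' hxv hxw)
  have h2 := hpt.det2_cycSucc_neg hM hji (fun h => hcon (by rw [← h, hj]))
  rw [hiv, ← hxs, hj] at h2
  linarith

lemma apply_cycPred (hf : ConvexLabelling S f m p) {M : ℕ} {pt : Fin M → Pt} (hpt : CWList pt)
    (himg : Finset.univ.image pt = S) (hM : 0 < M) {i : Fin M} {v w : ℤ} (hv : m ≤ v ∧ v ≤ p)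
    (hw : m ≤ w ∧ w ≤ p) (hvw : v ≠ w) (hiv : pt i = f v)
    (hcyc : ∀ x, m ≤ x → x ≤ p → x ≠ v → x ≠ w → Cyc v w x) : pt (cycPred hM i) = f w := by
  obtain ⟨x, hx, hx', hxp⟩ := (hf.mem_iff (pt (cycPred hM i))).1
    (himg ▸ Finset.mem_image_of_mem _ (Finset.mem_univ _))
  by_contra hcon
  have hxw : x ≠ w := by
    rintro rfl
    exact hcon hxp.symm
  obtain ⟨j, -, hj⟩ := Finset.mem_image.1 (himg.symm ▸ hf.mem hw.1 hw.2 : f w ∈ _)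
  have hji : j ≠ i := by
    rintro rfl
    exact hvw (hf.inj _ _ hv.1 hv.2 hw.1 hw.2 (by rw [← hiv, hj]))
  have hM' : 1 < M := by
    rw [Ne, Fin.ext_iff] at hji
    omega
  have hsp := cycSucc_cycPred hM i
  have hxv : x ≠ v := by
    rintro rfl
    have := hpt.1 (hxp.symm.trans hiv.symm)
    have h3 := cycSucc_ne hM hM' (cycPred hM i)
    rw [hsp] at h3
    exact h3 this.symm
  have h1 := hf.det2_pos hv hw ⟨hx, hx'⟩ (hcyc x hx hx' hxv hxw)
  have h2 := hpt.det2_cycSucc_neg hM (i := cycPred hM i) (j := j)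
    (fun h => hcon (by rw [← h, hj])) (by rwa [hsp])
  rw [hsp, hiv, ← hxp, hj, det2_rotate, det2_rotate] at h2
  linarith

lemma isHullList (hf : ConvexLabelling S f m p) (hS : ConvexPosition S) :
    IsHullList S (fun i : Fin (p - m + 1).toNat => f (p - (i : ℕ))) := by
  rw [IsHullList, hullPts_eq_self hS]
  refine ⟨⟨fun i j hij => ?_, fun i j k hij hjk => ?_⟩, ?_⟩
  · have := i.2
    have := j.2
    have := hf.inj _ _ (by omega) (by omega) (by omega) (by omega) hij
    ext
    omega
  · rw [Fin.lt_def] at hij hjk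
    have := k.2
    have := hf.ccw (p - (k : ℕ)) (p - (j : ℕ)) (p - (i : ℕ)) (by omega) (by omega) (by omega)
      (by omega)
    rw [det2_rotate] at this
    dsimp only
    rw [det2_swap]
    linarith
  · ext q
    rw [Finset.mem_image, hf.mem_iff]
    constructor
    · rintro ⟨i, -, rfl⟩
      have := i.2
      exact ⟨_, by omega, by omega, rfl⟩
    · rintro ⟨x, hx, hx', rfl⟩
      refine ⟨⟨(p - x).toNat, by omega⟩, Finset.mem_univ _, ?_⟩
      simp only
      congr 1
      omega

end ConvexLabelling

end Radial

section Special

/-- On the labels `m, …, p`, `h` goes up at the points of `A` and down at those of `C`, and returns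
to its starting value. -/
structure Walk (A C : Finset Pt) (f : ℤ → Pt) (h : ℤ → ℤ) (m p : ℤ) : Prop where
  step : ∀ x, m ≤ x → x ≤ p →
    (f x ∈ A ∧ f x ∉ C ∧ h x = h (x - 1) + 1) ∨ (f x ∈ C ∧ f x ∉ A ∧ h x = h (x - 1) - 1)
  closed : h p = h (m - 1)

namespace ConvexLabelling

variable {S A C : Finset Pt} {f : ℤ → Pt} {h : ℤ → ℤ} {m p : ℤ}

lemma ccw_zero_iff (hf : ConvexLabelling S f m p) (hw : Walk A C f h m p) (hm : m ≤ 0)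
    (hp : 0 < p) (h0 : f 0 ∈ A) :
    (∀ (k : ℕ) (q : Fin k → Pt), CCWOrder (f 0) q (S.erase (f 0)) →
      ∀ j, FirstBalanced A C q j → q j = f p) ↔
      (∀ x, 0 ≤ x → x < p → h x ≠ h 0 - 1) ∧ h p = h 0 - 1 := by
  set u : ℕ → ℤ := fun t => if (t : ℤ) < p then t + 1 else m + t - p with hu
  set H : ℕ → ℤ := fun t => if (t : ℤ) ≤ p then h t else h (m - 1 + t - p) with hH
  have hz : h 0 = h (-1) + 1 := by
    rcases hw.step 0 hm hp.le with ⟨-, -, h1⟩ | ⟨-, h1, -⟩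
    · simpa using h1
    · exact absurd h0 h1
  have hord : OrderedBy (fun a b => 0 < det2 (f 0) a b)
      (fun i : Fin (p - m).toNat => f (u i)) (S.erase (f 0)) := by
    refine hf.ccwOrder ⟨hm, hp.le⟩ (fun t ht => ?_) (fun x hx hx' hx0 => ?_) fun s t hst ht => ?_
    · simp only [hu]
      split_ifs <;> omega
    · rcases lt_or_gt_of_ne hx0 with h1 | h1
      · exact ⟨(x - m + p).toNat, by omega, by simp only [hu]; split_ifs <;> omega⟩
      · exact ⟨(x - 1).toNat, by omega, by simp only [hu]; split_ifs <;> omega⟩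
    · simp only [hu, Cyc]
      split_ifs <;> omega
  have hstep : ∀ i : Fin (p - m).toNat,
      (f (u i) ∈ A ∧ f (u i) ∉ C ∧ H (i + 1) = H i + 1) ∨
        (f (u i) ∈ C ∧ f (u i) ∉ A ∧ H (i + 1) = H i - 1) := fun i => by
    have hi := i.2
    have hHi : H i = h (u i - 1) := by
      simp only [hu, hH]
      split_ifs with h1 h2 h2
      · congr 1; omega
      · rw [show ((i : ℕ) : ℤ) = p by omega, hw.closed]
        congr 1; omega
      · omega
      · congr 1; omega
    have hHi' : H (i + 1) = h (u i) := by
      simp only [hu, hH]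
      push_cast
      split_ifs
      all_goals first | omega | (congr 1; omega)
    rw [hHi, hHi']
    refine hw.step _ ?_ ?_ <;> simp only [hu] <;> split_ifs <;> omega
  have hH0 : H 0 = h 0 := by simp [hH, hp.le]
  have hK : H (p - m).toNat = H 0 - 1 := by
    rw [hH0, hz]
    simp only [hH]
    split_ifs
    · obtain rfl : m = 0 := by omega
      rw [show (((p - 0).toNat : ℕ) : ℤ) = p by omega, hw.closed]
      simp
    · rw [show m - 1 + ((p - m).toNat : ℤ) - p = -1 by omega]
      simp
  have key := forall_firstBalanced_iff (fun a b h1 h2 => by rw [det2_swap] at h2; linarith) hord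
    hstep hK ⟨(p - 1).toNat, by omega⟩
  have hj : f (u (p - 1).toNat) = f p := by
    simp only [hu]
    congr 1
    split_ifs <;> omega
  have hHp : H ((p - 1).toNat + 1) = h p := by
    simp only [hH]
    push_cast
    split_ifs
    all_goals first | omega | (congr 1; omega)
  simp only [hj, hHp, hH0] at key
  refine key.trans (and_congr_left fun _ => ⟨fun h1 x hx hx' => ?_, fun h1 t ht => ?_⟩)
  · have := h1 x.toNat (by omega)
    simp only [hH] at this
    rw [if_pos (by omega), Int.toNat_of_nonneg hx] at this
    exact this
  · simp only [hH]
    rw [if_pos (by omega)]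
    exact h1 t (by omega) (by omega)

lemma cw_zero_iff (hf : ConvexLabelling S f m p) (hw : Walk A C f h m p) (hm : m ≤ 0)
    (hp : 0 < p) (h0 : f 0 ∈ A) :
    (∀ (k : ℕ) (q : Fin k → Pt), CWOrder (f 0) q (S.erase (f 0)) →
      ∀ j, FirstBalanced A C q j → q j = f p) ↔
      (∀ x, m ≤ x → x ≤ 0 → h (x - 1) ≠ h (-1) + 1) ∧ h (p - 1) = h (-1) + 1 := by
  set u : ℕ → ℤ := fun t => if (t : ℤ) < -m then -1 - t else p - (t + m) with hu
  set H : ℕ → ℤ := fun t => if (t : ℤ) ≤ -m then h (-1) - h (-1 - t) else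
    h (-1) - h (p - (t + m)) with hH
  have hz : h 0 = h (-1) + 1 := by
    rcases hw.step 0 hm hp.le with ⟨-, -, h1⟩ | ⟨-, h1, -⟩
    · simpa using h1
    · exact absurd h0 h1
  have hord : OrderedBy (fun a b => det2 (f 0) a b < 0)
      (fun i : Fin (p - m).toNat => f (u i)) (S.erase (f 0)) := by
    refine hf.cwOrder ⟨hm, hp.le⟩ (fun t ht => ?_) (fun x hx hx' hx0 => ?_) fun s t hst ht => ?_
    · simp only [hu]
      split_ifs <;> omega
    · rcases lt_or_gt_of_ne hx0 with h1 | h1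
      · exact ⟨(-1 - x).toNat, by omega, by simp only [hu]; split_ifs <;> omega⟩
      · exact ⟨(p - x - m).toNat, by omega, by simp only [hu]; split_ifs <;> omega⟩
    · simp only [hu, Cyc]
      split_ifs <;> omega
  have hstep : ∀ i : Fin (p - m).toNat,
      (f (u i) ∈ A ∧ f (u i) ∉ C ∧ H (i + 1) = H i + 1) ∨
        (f (u i) ∈ C ∧ f (u i) ∉ A ∧ H (i + 1) = H i - 1) := fun i => by
    have hi := i.2
    have hHi : H i = h (-1) - h (u i) := by
      simp only [hu, hH]
      split_ifs with h1 h2 h2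
      · rfl
      · rw [show -1 - ((i : ℕ) : ℤ) = m - 1 by omega, ← hw.closed]
        congr 2; omega
      · omega
      · rfl
    have hHi' : H (i + 1) = h (-1) - h (u i - 1) := by
      simp only [hu, hH]
      push_cast
      split_ifs
      all_goals first | omega | (congr 2; omega)
    rw [hHi, hHi']
    have : m ≤ u i ∧ u i ≤ p := by simp only [hu]; split_ifs <;> omega
    rcases hw.step _ this.1 this.2 with ⟨h1, h2, h3⟩ | ⟨h1, h2, h3⟩
    · exact Or.inl ⟨h1, h2, by rw [h3]; ring⟩
    · exact Or.inr ⟨h1, h2, by rw [h3]; ring⟩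
  have hH0 : H 0 = 0 := by simp [hH, hm]
  have hK : H (p - m).toNat = H 0 - 1 := by
    rw [hH0]
    simp only [hH]
    rw [if_neg (by omega), show p - (((p - m).toNat : ℤ) + m) = 0 by omega, hz]
    ring
  have key := forall_firstBalanced_iff (fun a b h1 h2 => by rw [det2_swap] at h2; linarith) hord
    hstep hK ⟨(-m).toNat, by omega⟩
  have hj : f (u (-m).toNat) = f p := by
    simp only [hu]
    congr 1
    split_ifs <;> omega
  have hHp : H ((-m).toNat + 1) = h (-1) - h (p - 1) := by
    simp only [hH]
    push_cast
    rw [if_neg (by omega)]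
    congr 2; omega
  simp only [hj, hHp, hH0] at key
  refine key.trans (and_congr ⟨fun h1 x hx hx' => ?_, fun h1 t ht => ?_⟩ (by omega))
  · have := h1 (-x).toNat (by omega)
    simp only [hH] at this
    rw [if_pos (by omega), show -1 - ((-x).toNat : ℤ) = x - 1 by omega] at this
    omega
  · simp only [hH]
    rw [if_pos (by omega)]
    have := h1 (-t) (by omega) (by omega)
    rw [show -(t : ℤ) - 1 = -1 - t by ring] at this
    omega

lemma ccw_last (hf : ConvexLabelling S f m p) (hw : Walk A C f h m p) (hm : m ≤ 0)
    (hp : 0 < p) (hpC : f p ∈ C) (h1 : ∀ x, m ≤ x → x ≤ 0 → h (x - 1) ≠ h p + 1)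
    (h2 : h 0 = h p + 1) :
    ∀ (k : ℕ) (q : Fin k → Pt), CCWOrder (f p) q (S.erase (f p)) →
      ∀ j, FirstBalanced C A q j → q j = f 0 := by
  set H : ℕ → ℤ := fun t => - h (m - 1 + t) with hH
  have hz : h p = h (p - 1) - 1 := by
    rcases hw.step p (by omega) le_rfl with ⟨-, h1, -⟩ | ⟨-, -, h1⟩
    · exact absurd hpC h1
    · exact h1
  have hord : OrderedBy (fun a b => 0 < det2 (f p) a b)
      (fun i : Fin (p - m).toNat => f (m + (i : ℕ))) (S.erase (f p)) := by
    refine hf.ccwOrder (u := fun t => m + t) ⟨by omega, le_rfl⟩ (fun t ht => by omega)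
      (fun x hx hx' hxp => ⟨(x - m).toNat, by omega, by omega⟩) fun s t hst ht => ?_
    simp only [Cyc]
    omega
  have hstep : ∀ i : Fin (p - m).toNat,
      (f (m + (i : ℕ)) ∈ C ∧ f (m + (i : ℕ)) ∉ A ∧ H (i + 1) = H i + 1) ∨
        (f (m + (i : ℕ)) ∈ A ∧ f (m + (i : ℕ)) ∉ C ∧ H (i + 1) = H i - 1) := fun i => by
    have hi := i.2
    simp only [hH]
    push_cast
    rw [show m - 1 + (((i : ℕ) : ℤ) + 1) = m + (i : ℕ) by ring,
      show m - 1 + ((i : ℕ) : ℤ) = m + (i : ℕ) - 1 by ring]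
    rcases hw.step (m + (i : ℕ)) (by omega) (by omega) with ⟨h1, h2, h3⟩ | ⟨h1, h2, h3⟩
    · exact Or.inr ⟨h1, h2, by rw [h3]; ring⟩
    · exact Or.inl ⟨h1, h2, by rw [h3]; ring⟩
  have hH0 : H 0 = - h p := by simp [hH, hw.closed]
  have hK : H (p - m).toNat = H 0 - 1 := by
    rw [hH0, hz]
    simp only [hH]
    rw [show m - 1 + ((p - m).toNat : ℤ) = p - 1 by omega]
    ring
  have key := forall_firstBalanced_iff (fun a b h1 h2 => by rw [det2_swap] at h2; linarith) hord
    hstep hK ⟨(-m).toNat, by omega⟩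
  have hj : f (m + ((-m).toNat : ℤ)) = f 0 := by
    congr 1
    omega
  simp only [hj, hH0] at key
  refine key.2 ⟨fun t ht => ?_, ?_⟩
  · have := h1 (m + t) (by omega) (by omega)
    simp only [hH]
    rw [show m - 1 + (t : ℤ) = m + t - 1 by ring]
    omega
  · simp only [hH]
    push_cast
    rw [show m - 1 + (((-m).toNat : ℤ) + 1) = 0 by omega]
    omega

lemma cw_last (hf : ConvexLabelling S f m p) (hw : Walk A C f h m p) (hm : m ≤ 0)
    (hp : 0 < p) (hpC : f p ∈ C) (h1 : ∀ x, 0 ≤ x → x < p → h x ≠ h (p - 1) - 1)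
    (h2 : h (-1) = h (p - 1) - 1) :
    ∀ (k : ℕ) (q : Fin k → Pt), CWOrder (f p) q (S.erase (f p)) →
      ∀ j, FirstBalanced C A q j → q j = f 0 := by
  set H : ℕ → ℤ := fun t => h (p - 1 - t) with hH
  have hz : h p = h (p - 1) - 1 := by
    rcases hw.step p (by omega) le_rfl with ⟨-, h1, -⟩ | ⟨-, -, h1⟩
    · exact absurd hpC h1
    · exact h1
  have hord : OrderedBy (fun a b => det2 (f p) a b < 0)
      (fun i : Fin (p - m).toNat => f (p - 1 - (i : ℕ))) (S.erase (f p)) := by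
    refine hf.cwOrder (u := fun t => p - 1 - t) ⟨by omega, le_rfl⟩ (fun t ht => by omega)
      (fun x hx hx' hxp => ⟨(p - 1 - x).toNat, by omega, by omega⟩) fun s t hst ht => ?_
    simp only [Cyc]
    omega
  have hstep : ∀ i : Fin (p - m).toNat,
      (f (p - 1 - (i : ℕ)) ∈ C ∧ f (p - 1 - (i : ℕ)) ∉ A ∧ H (i + 1) = H i + 1) ∨
        (f (p - 1 - (i : ℕ)) ∈ A ∧ f (p - 1 - (i : ℕ)) ∉ C ∧ H (i + 1) = H i - 1) := fun i => by
    have hi := i.2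
    simp only [hH]
    push_cast
    rw [← sub_sub]
    rcases hw.step (p - 1 - (i : ℕ)) (by omega) (by omega) with ⟨h1, h2, h3⟩ | ⟨h1, h2, h3⟩
    · exact Or.inr ⟨h1, h2, by rw [h3]; ring⟩
    · exact Or.inl ⟨h1, h2, by rw [h3]; ring⟩
  have hH0 : H 0 = h (p - 1) := by simp [hH]
  have hK : H (p - m).toNat = H 0 - 1 := by
    rw [hH0, ← hz, hw.closed]
    simp only [hH]
    congr 1
    omega
  have key := forall_firstBalanced_iff (fun a b h1 h2 => by rw [det2_swap] at h2; linarith) hord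
    hstep hK ⟨(p - 1).toNat, by omega⟩
  have hj : f (p - 1 - ((p - 1).toNat : ℤ)) = f 0 := by
    congr 1
    omega
  simp only [hj, hH0] at key
  refine key.2 ⟨fun t ht => h1 _ (by omega) (by omega), ?_⟩
  simp only [hH]
  push_cast
  rw [← h2]
  congr 1
  omega

end ConvexLabelling

lemma le_of_forall_ne_sub_one {h : ℤ → ℤ} {a : ℤ} (n : ℕ)
    (hstep : ∀ x, a < x → x ≤ a + n → h (x - 1) - 1 ≤ h x)
    (hne : ∀ x, a ≤ x → x ≤ a + n → h x ≠ h a - 1) : h a ≤ h (a + n) := by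
  induction n with
  | zero => simp
  | succ n ih =>
    have h1 := ih (fun x hx hx' => hstep x hx (by push_cast; omega))
      fun x hx hx' => hne x hx (by push_cast; omega)
    have h2 := hstep (a + (n + 1 : ℕ)) (by omega) le_rfl
    have h3 := hne (a + (n + 1 : ℕ)) (by omega) le_rfl
    rw [show a + ((n + 1 : ℕ) : ℤ) - 1 = a + n by push_cast; ring] at h2
    omega

lemma le_of_forall_ne_add_one {h : ℤ → ℤ} {a : ℤ} (n : ℕ)
    (hstep : ∀ x, a - n < x → x ≤ a → h x - 1 ≤ h (x - 1) ∧ h (x - 1) ≤ h x + 1)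
    (hne : ∀ x, a - n ≤ x → x ≤ a → h x ≠ h a + 1) : h (a - n) ≤ h a := by
  induction n with
  | zero => simp
  | succ n ih =>
    have h1 := ih (fun x hx hx' => hstep x (by push_cast; omega) hx')
      fun x hx hx' => hne x (by push_cast; omega) hx'
    have h2 := hstep (a - n) (by push_cast; omega) (by omega)
    have h3 := hne (a - (n + 1 : ℕ)) le_rfl (by push_cast; omega)
    rw [show a - (n : ℤ) - 1 = a - (n + 1 : ℕ) by push_cast; ring] at h2
    omega

lemma ConvexLabelling.specialConfig_iff {R B : Finset Pt} (hconv : ConvexPosition (R ∪ B))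
    {f : ℤ → Pt} {h : ℤ → ℤ} {m p : ℤ} (hf : ConvexLabelling (R ∪ B) f m p)
    (hw : Walk R B f h m p) (hm : m ≤ 0) (hp : 0 < p) (h0 : f 0 ∈ R) (hpB : f p ∈ B) :
    SpecialConfig R B (f 0) (f p) ↔ SpecialHeights h m p := by
  have hz : h 0 = h (-1) + 1 := by
    rcases hw.step 0 hm hp.le with ⟨-, -, h1⟩ | ⟨-, h1, -⟩
    · simpa using h1
    · exact absurd h0 h1
  have hl : h p = h (p - 1) - 1 := by
    rcases hw.step p (by omega) le_rfl with ⟨-, h1, -⟩ | ⟨-, -, h1⟩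
    · exact absurd hpB h1
    · exact h1
  have hd : ∀ x, m ≤ x → x ≤ p → h x = h (x - 1) + 1 ∨ h x = h (x - 1) - 1 := fun x hx hx' =>
    (hw.step x hx hx').imp (·.2.2) (·.2.2)
  constructor
  · rintro ⟨-, -, hi, hii, -⟩
    obtain ⟨hccw, hpv⟩ := (hf.ccw_zero_iff hw hm hp h0).1 fun k q hq => hii k q (Or.inl hq)
    obtain ⟨hcw, hqv⟩ := (hf.cw_zero_iff hw hm hp h0).1 fun k q hq => hii k q (Or.inr hq)
    have hM : 0 < (p - m + 1).toNat := by omega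
    have hnb := (hi _ hM _ (hf.isHullList hconv) ⟨p.toNat, by omega⟩).1
      (congrArg f (by simp only; omega))
    have hpne : f p ∉ R := by
      rcases hw.step p (by omega) le_rfl with ⟨-, h1, -⟩ | ⟨-, h1, -⟩
      · exact absurd hpB h1
      · exact h1
    have himg := (hf.isHullList hconv).2
    rw [hullPts_eq_self hconv] at himg
    have hi0 : (fun i : Fin (p - m + 1).toNat => f (p - (i : ℕ))) ⟨p.toNat, by omega⟩ = f 0 :=
      congrArg f (by simp only; omega)
    refine ⟨?_, ?_, by omega, fun x hx hx' => ?_, fun x hx hx' => ?_⟩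
    · by_contra hcon
      refine hpne ?_
      rw [← hf.apply_cycPred (hf.isHullList hconv).1 himg hM ⟨hm, hp.le⟩ ⟨by omega, le_rfl⟩ hp.ne
        hi0 fun x hx hx' hx0 hxp => by simp only [Cyc]; omega]
      exact hnb.1
    · by_contra hcon
      refine hpne ?_
      rw [← hf.apply_cycSucc (hf.isHullList hconv).1 himg hM ⟨hm, hp.le⟩ ⟨by omega, le_rfl⟩ hp.ne
        hi0 fun x hx hx' hx0 hxp => by simp only [Cyc]; omega]
      exact hnb.2
    · have := le_of_forall_ne_sub_one (h := h) (a := 0) x.toNat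
        (fun y hy hy' => by have := hd y (by omega) (by omega); omega)
        fun y hy hy' => hccw y hy (by omega)
      rwa [zero_add, Int.toNat_of_nonneg hx] at this
    · have := le_of_forall_ne_add_one (h := h) (a := -1) (-x).toNat
        (fun y hy hy' => by have := hd y (by omega) (by omega); omega)
        fun y hy hy' => by
          have := hcw (y + 1) (by omega) (by omega)
          rwa [add_sub_cancel_right] at this
      rwa [show -1 - ((-x).toNat : ℤ) = x - 1 by omega] at this
  · rintro ⟨hp1, hm1, hpv, hge, hle⟩
    refine ⟨?_, ?_, fun M hM pt hpt i => ?_, fun k q hq => ?_, fun k q hq => ?_⟩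
    · rw [hullPts_eq_self hconv]
      exact Finset.mem_union_left _ h0
    · rw [hullPts_eq_self hconv]
      exact Finset.mem_union_right _ hpB
    · obtain ⟨hcl, himg⟩ := hpt
      rw [hullPts_eq_self hconv] at himg
      refine ⟨fun hi => ?_, fun hi => ?_⟩
      · rw [hf.apply_cycPred hcl himg hM (w := 1) ⟨hm, hp.le⟩ ⟨by omega, by omega⟩ (by omega) hi
          fun x hx hx' hx0 hxp => by simp only [Cyc]; omega,
          hf.apply_cycSucc hcl himg hM (w := -1) ⟨hm, hp.le⟩ ⟨by omega, by omega⟩ (by omega) hi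
          fun x hx hx' hx0 hxp => by simp only [Cyc]; omega]
        constructor
        · rcases hw.step 1 (by omega) (by omega) with ⟨h1, -, -⟩ | ⟨-, -, h1⟩
          · exact h1
          · have := hge 1 (by omega) hp1
            norm_num at h1
            omega
        · rcases hw.step (-1) (by omega) (by omega) with ⟨h1, -, -⟩ | ⟨-, -, h1⟩
          · exact h1
          · have := hle (-1) (by omega) (by omega)
            omega
      · rw [hf.apply_cycPred hcl himg hM (w := m) ⟨by omega, le_rfl⟩ ⟨by omega, by omega⟩
          (by omega) hi fun x hx hx' hx0 hxp => by simp only [Cyc]; omega,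
          hf.apply_cycSucc hcl himg hM (w := p - 1) ⟨by omega, le_rfl⟩ ⟨by omega, by omega⟩
          (by omega) hi fun x hx hx' hx0 hxp => by simp only [Cyc]; omega]
        constructor
        · rcases hw.step m (by omega) (by omega) with ⟨-, -, h1⟩ | ⟨h1, -, -⟩
          · have := hle (m + 1) (by omega) (by omega)
            rw [add_sub_cancel_right] at this
            have := hw.closed
            omega
          · exact h1
        · rcases hw.step (p - 1) (by omega) (by omega) with ⟨-, -, h1⟩ | ⟨h1, -, -⟩
          · have := hge (p - 1 - 1) (by omega) (by omega)
            omega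
          · exact h1
    · rcases hq with hq | hq
      · exact (hf.ccw_zero_iff hw hm hp h0).2
          ⟨fun x hx hx' => by have := hge x hx hx'; omega, by omega⟩ k q hq
      · exact (hf.cw_zero_iff hw hm hp h0).2
          ⟨fun x hx hx' => by have := hle x hx hx'; omega, by omega⟩ k q hq
    · rcases hq with hq | hq
      · exact hf.ccw_last hw hm hp hpB
          (fun x hx hx' => by have := hle x hx hx'; omega) (by omega) k q hq
      · exact hf.cw_last hw hm hp hpB
          (fun x hx hx' => by have := hge x hx hx'; omega) (by omega) k q hq

/-- The sum of the colours over all labels is `|R| - |B|`. -/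
lemma ConvexLabelling.sum_colour {R B : Finset Pt} (hdisj : Disjoint R B) {f : ℤ → Pt} {m p : ℤ}
    (hf : ConvexLabelling (R ∪ B) f m p) :
    ∑ x ∈ Finset.Icc m p, colour R f x = (R.card : ℤ) - B.card := by
  have himg : (Finset.Icc m p).image f = R ∪ B := by
    ext q
    rw [Finset.mem_image, hf.mem_iff]
    simp [and_assoc]
  have h1 : ∑ x ∈ Finset.Icc m p, colour R f x = ∑ q ∈ R ∪ B, (if q ∈ R then (1 : ℤ) else -1) := by
    rw [← himg, Finset.sum_image]
    · rfl
    · intro x hx y hy hxy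
      rw [Finset.mem_coe, Finset.mem_Icc] at hx hy
      exact hf.inj _ _ hx.1 hx.2 hy.1 hy.2 hxy
  rw [h1, Finset.sum_union hdisj, Finset.sum_congr rfl fun q hq => if_pos hq,
    Finset.sum_congr (g := fun _ => (-1 : ℤ)) (s₁ := B) rfl fun q hq =>
      if_neg (Finset.disjoint_right.1 hdisj hq)]
  simp [sub_eq_add_neg]

end Special

/-- Theorem 3.7: let `S = R ∪ B` be in convex position with `|R| = |B| = n ≥ 1` and let
`r ∈ R`, `b ∈ B`.  There exists a 1-plane Hamiltonian alternating path on `S` with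
endpoints `r` and `b` if and only if the configuration `(S, r, b)` is non-special. -/
theorem stmt12 (n : ℕ) (hn : 1 ≤ n) (R B : Finset Pt)
    (hdisj : Disjoint R B)
    (hconv : ConvexPosition (R ∪ B))
    (hR : R.card = n) (hB : B.card = n)
    (r b : Pt) (hr : r ∈ R) (hb : b ∈ B) :
    (∃ P : HamAltPath R B r b, OnePlane (pathEdges P.verts)) ↔
      ¬ SpecialConfig R B r b := by
  have hrb : r ≠ b := fun h => Finset.disjoint_left.1 hdisj hr (h ▸ hb)
  obtain ⟨f, m, p, hm, hp, rfl, rfl, hf⟩ := exists_convexLabelling hconv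
    (Finset.mem_union_left _ hr) (Finset.mem_union_right _ hb) hrb
  set c := colour R f with hc
  set h : ℤ → ℤ := fun x => ∑ y ∈ Finset.Ioc (m - 1) x, c y with hh
  have hsucc : ∀ x, m ≤ x → h x = h (x - 1) + c x := fun x hx => by
    have : Finset.Ioc (m - 1) x = insert x (Finset.Ioc (m - 1) (x - 1)) := by
      ext y
      rw [Finset.mem_insert, Finset.mem_Ioc, Finset.mem_Ioc]
      omega
    simp only [hh]
    rw [this, Finset.sum_insert (by simp), add_comm]
  have hbal : h p = h (m - 1) := by
    have : Finset.Ioc (m - 1) p = Finset.Icc m p := by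
      ext y
      rw [Finset.mem_Ioc, Finset.mem_Icc]
      omega
    simp only [hh]
    rw [this, hf.sum_colour hdisj, hR, hB]
    simp
  have hheight : IsHeight c h m p := fun x hx _ => by
    refine ⟨?_, hsucc x hx⟩
    rw [hc, colour]
    split_ifs <;> simp
  have hw : Walk R B f h m p := by
    refine ⟨fun x hx hx' => ?_, hbal⟩
    rw [hsucc x hx, hc, colour]
    rcases Finset.mem_union.1 (hf.mem hx hx') with h1 | h1
    · exact Or.inl ⟨h1, Finset.disjoint_left.1 hdisj h1, by rw [if_pos h1]⟩
    · have h2 := Finset.disjoint_right.1 hdisj h1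
      exact Or.inr ⟨h1, h2, by rw [if_neg h2]; ring⟩
  have hc0 : c 0 = 1 := if_pos hr
  have hcp : c p = -1 := if_neg (Finset.disjoint_right.1 hdisj hb)
  rw [hf.exists_hamAltPath_iff hdisj hm hp, hf.specialConfig_iff hconv hw hm hp hr hb]
  exact ⟨fun hpath hs => not_hasPath_of_specialHeights hheight hc0 hcp hbal hs hpath,
    hasPath_of_not_specialHeights hheight hm hp hc0 hcp hbal⟩
end
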